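/- arXiv:1702.04609 — 3 statements merged into one kernel-verified Lean document; each statement's English description precedes it below -/
import Mathlib

section
/- (Gromoll–Meyer Splitting Lemma.) Let f : ℝ^{n₁} × ℝ^{n₂} → ℝ be a smooth (C^∞) function such that (0,0) is an isolated critical point of f. Assume the second derivative D²f(0,0), viewed as a symmetric bilinear form on ℝ^{n₁} × ℝ^{n₂}, preserves the splitting, i.e. D²f(0,0)((u,0),(0,v)) = 0 for all u ∈ ℝ^{n₁}, v ∈ ℝ^{n₂}, and that its kernel {w : D²f(0,0)(w,w') = 0 for all w'} is contained in ℝ^{n₁} × {0}. Then there exist an open neighborhood U of (0,0), a smooth injective map Ψ : U → ℝ^{n₁} × ℝ^{n₂} with Ψ(0,0) = (0,0) and DΨ(0,0) = id, and smooth functions g : ℝ^{n₁} → ℝ and h : ℝ^{n₂} → ℝ such that f(Ψ(z₁,z₂)) = g(z₁) + h(z₂) for all (z₁,z₂) ∈ U, the point 0 ∈ ℝ^{n₂} is a nondegenerate critical point of h (Dh(0) = 0 and D²h(0) is a nondegenerate bilinear form), D²g(0) equals the restriction of D²f(0,0) to ℝ^{n₁} × {0}, and D²h(0) equals the restriction of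 D²f(0,0) to {0} × ℝ^{n₂}. -/
/-- Euclidean space `ℝ^n`. -/
abbrev Eu (n : ℕ) : Type := EuclideanSpace ℝ (Fin n)

section SplittingLemma

open Set Filter Topology
open scoped ContDiff

variable {E F G : Type} [NormedAddCommGroup E] [NormedSpace ℝ E]
  [NormedAddCommGroup F] [NormedSpace ℝ F] [NormedAddCommGroup G] [NormedSpace ℝ G]

/-- A function smooth near `b` agrees near `b` with a globally smooth function. -/
theorem exists_contDiff_eventuallyEq [FiniteDimensional ℝ E] {k : E → G} {b : E}
    (hk : ∀ᶠ y in 𝓝 b, ContDiffAt ℝ ∞ k y) :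
    ∃ k' : E → G, ContDiff ℝ ∞ k' ∧ k' =ᶠ[𝓝 b] k := by
  obtain ⟨r, hr, hball⟩ := Metric.eventually_nhds_iff_ball.1 hk
  let χ : ContDiffBump b := ⟨r / 4, r / 2, by positivity, by linarith⟩
  refine ⟨fun y => χ y • k y, contDiff_iff_contDiffAt.2 fun y => ?_, ?_⟩
  · by_cases hy : y ∈ Metric.ball b r
    · exact χ.contDiff.contDiffAt.smul (hball y hy)
    · have hy' : y ∉ tsupport χ := by
        rw [χ.tsupport_eq]
        intro h
        have : dist y b ≤ r / 2 := h
        exact hy (Metric.mem_ball.2 (by linarith))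
      have h0 : (fun y => χ y • k y) =ᶠ[𝓝 y] fun _ => 0 := by
        filter_upwards [notMem_tsupport_iff_eventuallyEq.1 hy'] with z hz
        simp [hz]
      exact contDiffAt_const.congr_of_eventuallyEq h0
  · filter_upwards [χ.eventuallyEq_one] with y hy
    simp [hy]

/-- Smooth inverse function theorem, with the local inverse extended to a global smooth map. -/
theorem exists_contDiff_local_inverse [FiniteDimensional ℝ E] [FiniteDimensional ℝ G]
    {f : E → G} (hf : ContDiff ℝ ∞ f) {f' : E ≃L[ℝ] G} {a : E}
    (hf' : HasFDerivAt f (f' : E →L[ℝ] G) a) :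
    ∃ k : G → E, ContDiff ℝ ∞ k ∧ (∀ᶠ x in 𝓝 a, k (f x) = x) ∧ ∀ᶠ y in 𝓝 (f a), f (k y) = y := by
  have := FiniteDimensional.complete ℝ E
  have hn : (∞ : WithTop ℕ∞) ≠ 0 := by simp
  let e := hf.contDiffAt.toOpenPartialHomeomorph f hf' hn
  have ha : a ∈ e.source := hf.contDiffAt.mem_toOpenPartialHomeomorph_source hf' hn
  have hfa : f a ∈ e.target := hf.contDiffAt.image_mem_toOpenPartialHomeomorph_target hf' hn
  have hef : (e : E → G) = f := rfl
  have hsymm : e.symm (f a) = a := e.left_inv ha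
  have hcd : ∀ᶠ y in 𝓝 (f a), ContDiffAt ℝ ∞ e.symm y := by
    have h1 : ∀ᶠ x in 𝓝 a, fderiv ℝ f x ∈ range ((↑) : (E ≃L[ℝ] G) → E →L[ℝ] G) := by
      apply (hf.continuous_fderiv (by simp)).continuousAt.eventually
      rw [hf'.fderiv]
      exact ContinuousLinearEquiv.nhds f'
    have h2 : Tendsto e.symm (𝓝 (f a)) (𝓝 a) := by
      simpa [ContinuousAt, hsymm] using e.continuousAt_symm hfa
    filter_upwards [h2.eventually h1, e.open_target.mem_nhds hfa] with y ⟨e', he'⟩ hy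
    refine e.contDiffAt_symm hy (f₀' := e') ?_ hf.contDiffAt
    rw [he']
    exact (hf.differentiable (by simp) _).hasFDerivAt
  obtain ⟨k, hk, hke⟩ := exists_contDiff_eventuallyEq hcd
  refine ⟨k, hk, ?_, ?_⟩
  · filter_upwards [hf.continuous.continuousAt.eventually hke,
      e.open_source.mem_nhds ha] with x hx hxs
    rw [hx]
    exact e.left_inv hxs
  · filter_upwards [hke, e.open_target.mem_nhds hfa] with y hy hys
    rw [hy]
    exact e.right_inv hys

theorem contDiff_intervalIntegral [FiniteDimensional ℝ E] {K : E × ℝ → G}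
    (hK : ContDiff ℝ ∞ K) (a b : ℝ) :
    ContDiff ℝ ∞ fun x => ∫ t in a..b, K (x, t) := by
  have := FiniteDimensional.proper_real E
  rw [contDiff_infty]
  intro n
  induction n generalizing G with
  | zero =>
    rw [Nat.cast_zero, contDiff_zero]
    exact intervalIntegral.continuous_parametric_intervalIntegral_of_continuous'
      (f := fun x t => K (x, t)) hK.continuous a b
  | succ n ih =>
    rw [Nat.cast_succ, contDiff_succ_iff_hasFDerivAt]
    have hK' : ContDiff ℝ ∞ fun p : E × ℝ =>
        (fderiv ℝ K p).comp (ContinuousLinearMap.inl ℝ E ℝ) :=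
      (hK.fderiv_right (by simp)).clm_comp contDiff_const
    refine ⟨_, ih hK', fun x => ?_⟩
    obtain ⟨M, hM⟩ := ((isCompact_closedBall x 1).prod
      (isCompact_uIcc (a := a) (b := b))).exists_bound_of_continuousOn hK'.continuous.continuousOn
    have hc : ∀ x, Continuous fun t => K (x, t) := fun x => hK.continuous.comp (by fun_prop)
    refine intervalIntegral.hasFDerivAt_integral_of_dominated_of_fderiv_le
      (F := fun x t => K (x, t)) (bound := fun _ => M)
      (F' := fun x t => (fderiv ℝ K (x, t)).comp (ContinuousLinearMap.inl ℝ E ℝ))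
      (Metric.closedBall_mem_nhds x one_pos)
      (.of_forall fun x => (hc x).aestronglyMeasurable) ((hc x).intervalIntegrable _ _)
      (hK'.continuous.comp (by fun_prop : Continuous fun t : ℝ => (x, t))).aestronglyMeasurable
      (.of_forall fun t ht y hy => hM (y, t) ⟨hy, uIoc_subset_uIcc ht⟩)
      intervalIntegrable_const (.of_forall fun t _ y _ => ?_)
    exact ((hK.differentiable (by simp) (y, t)).hasFDerivAt).comp y (hasFDerivAt_prodMk_left y t)

/-- Hadamard's lemma with parameters. -/
theorem exists_contDiff_hadamard [FiniteDimensional ℝ E] [FiniteDimensional ℝ F] [CompleteSpace G]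
    {φ : E × F → G} (hφ : ContDiff ℝ ∞ φ) :
    ∃ a : E × F → F →L[ℝ] G, ContDiff ℝ ∞ a ∧ ∀ x y, φ (x, y) = φ (x, 0) + a (x, y) y := by
  let K : (E × F) × ℝ → F →L[ℝ] G := fun p =>
    (fderiv ℝ φ (p.1.1, p.2 • p.1.2)).comp (ContinuousLinearMap.inr ℝ E F)
  have hK : ContDiff ℝ ∞ K :=
    ((hφ.fderiv_right (m := ∞) (by simp)).comp
      (by fun_prop : ContDiff ℝ ∞ fun p : (E × F) × ℝ => (p.1.1, p.2 • p.1.2))).clm_comp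
        contDiff_const
  refine ⟨_, contDiff_intervalIntegral hK 0 1, fun x y => ?_⟩
  have hKc : Continuous fun t : ℝ => K ((x, y), t) := hK.continuous.comp (by fun_prop)
  have hd : ∀ t : ℝ, HasDerivAt (fun t : ℝ => φ (x, t • y)) (K ((x, y), t) y) t := by
    intro t
    have h1 : HasDerivAt (fun t : ℝ => (x, t • y)) ((0, y) : E × F) t := by
      simpa using (hasDerivAt_const t x).prodMk ((hasDerivAt_id t).smul_const y)
    exact (hφ.differentiable (by simp) (x, t • y)).hasFDerivAt.comp_hasDerivAt t h1
  rw [ContinuousLinearMap.intervalIntegral_apply (hKc.intervalIntegrable 0 1),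
    intervalIntegral.integral_eq_sub_of_hasDerivAt (fun t _ => hd t)
      ((hKc.clm_apply continuous_const).intervalIntegrable 0 1)]
  simp

theorem hasFDerivAt_clm_apply_self {a : F → F →L[ℝ] G} (ha : ContDiff ℝ ∞ a) (c : G) (y : F) :
    HasFDerivAt (fun y => c + a y y) (a y + (fderiv ℝ a y).flip y) y := by
  simpa using ((ha.differentiable (by simp) y).hasFDerivAt.clm_apply (hasFDerivAt_id y)).const_add c

theorem contDiff_clm_flip : ContDiff ℝ ∞ fun P : F →L[ℝ] F →L[ℝ] G => P.flip :=
  LinearIsometryEquiv.contDiff (𝕜 := ℝ) (n := ∞) (E := F →L[ℝ] F →L[ℝ] G)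
    (F := F →L[ℝ] F →L[ℝ] G) (ContinuousLinearMap.flipₗᵢ ℝ F F G)

theorem hasFDerivAt_fderiv_clm_apply_self {a : F → F →L[ℝ] G} (ha : ContDiff ℝ ∞ a) (c : G) :
    HasFDerivAt (fderiv ℝ fun y => c + a y y) (fderiv ℝ a 0 + (fderiv ℝ a 0).flip) 0 := by
  have h : (fderiv ℝ fun y => c + a y y) = fun y => a y + (fderiv ℝ a y).flip y :=
    funext fun y => (hasFDerivAt_clm_apply_self ha c y).fderiv
  rw [h]
  have ha' : ContDiff ℝ ∞ fun y => (fderiv ℝ a y).flip :=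
    (contDiff_clm_flip (G := G)).comp (ha.fderiv_right (m := ∞) (by simp))
  refine (ha.differentiable (by simp) 0).hasFDerivAt.add ?_
  simpa using (ha'.differentiable (by simp) 0).hasFDerivAt.clm_apply (hasFDerivAt_id 0)

theorem exists_continuousLinearEquiv_of_injective [FiniteDimensional ℝ F]
    (L : F →L[ℝ] F →L[ℝ] ℝ)
    (hL : ∀ v, (∀ w, L v w = 0) → v = 0) :
    ∃ e : F ≃L[ℝ] F →L[ℝ] ℝ, (e : F →L[ℝ] F →L[ℝ] ℝ) = L := by
  have hinj : Function.Injective (L : F →ₗ[ℝ] F →L[ℝ] ℝ) :=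
    (injective_iff_map_eq_zero _).2 fun v hv => hL v fun w => by
      have : L v = 0 := hv
      simp [this]
  have hrank : Module.finrank ℝ F = Module.finrank ℝ (F →L[ℝ] ℝ) := by
    rw [← (LinearMap.toContinuousLinearMap (𝕜 := ℝ) (E := F) (F' := ℝ)).finrank_eq]
    exact Subspace.dual_finrank_eq.symm
  refine ⟨(LinearEquiv.ofInjectiveOfFinrankEq _ hinj hrank).toContinuousLinearEquiv, ?_⟩
  ext v w
  rfl

/-- Near a nondegenerate symmetric form `Q`, symmetric forms `c` have a smooth symmetric
square root relative to `Q`. -/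
theorem exists_contDiff_sqrt [FiniteDimensional ℝ F]
    (Q : F ≃L[ℝ] F →L[ℝ] ℝ) (hQ : ∀ v w, Q v w = Q w v) :
    ∃ ρ : (F →L[ℝ] F →L[ℝ] ℝ) → F →L[ℝ] F →L[ℝ] ℝ, ContDiff ℝ ∞ ρ ∧ ρ Q = Q ∧
      ∀ᶠ c in 𝓝 (Q : F →L[ℝ] F →L[ℝ] ℝ), (∀ v w, c v w = c w v) →
        ∀ v, Q (Q.symm (ρ c v)) (Q.symm (ρ c v)) = c v v := by
  let q : (F →L[ℝ] ℝ) →L[ℝ] F := Q.symm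
  have hq : ∀ α β : F →L[ℝ] ℝ, α (q β) = β (q α) := fun α β => by
    have := hQ (q α) (q β)
    simpa [q] using this
  let S : (F →L[ℝ] F →L[ℝ] ℝ) → F →L[ℝ] F →L[ℝ] ℝ := fun P => P.comp (q.comp P)
  have hSQ : S Q = Q := by ext v w; simp [S, q]
  have hS : ContDiff ℝ ∞ S := contDiff_id.clm_comp (contDiff_const.clm_comp contDiff_id)
  have hS' : HasFDerivAt S ((ContinuousLinearEquiv.smulLeft (Units.mk0 (2 : ℝ) two_ne_zero) :
      (F →L[ℝ] F →L[ℝ] ℝ) ≃L[ℝ] _) : (F →L[ℝ] F →L[ℝ] ℝ) →L[ℝ] _) (Q : F →L[ℝ] F →L[ℝ] ℝ) := by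
    have hid : HasFDerivAt (fun P : F →L[ℝ] F →L[ℝ] ℝ => P) (.id ℝ _) Q := hasFDerivAt_id _
    have h0 : HasFDerivAt (fun P : F →L[ℝ] F →L[ℝ] ℝ => q.comp P)
        (ContinuousLinearMap.compL ℝ F (F →L[ℝ] ℝ) F q) Q :=
      (ContinuousLinearMap.compL ℝ F (F →L[ℝ] ℝ) F q).hasFDerivAt
    have h1 := HasFDerivAt.clm_comp (c := fun P : F →L[ℝ] F →L[ℝ] ℝ => P)
      (d := fun P : F →L[ℝ] F →L[ℝ] ℝ => q.comp P) hid h0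
    refine h1.congr_fderiv ?_
    ext H v w
    simp [q, two_smul, Units.smul_def]
  obtain ⟨ρ, hρ, hρS, hSρ⟩ := exists_contDiff_local_inverse hS hS'
  rw [hSQ] at hSρ
  have hρQ : ρ Q = Q := by simpa [hSQ] using hρS.self_of_nhds
  refine ⟨ρ, hρ, hρQ, ?_⟩
  let T := ContinuousLinearMap.flipₗᵢ ℝ F F ℝ
  have hTQ : T Q = Q := by ext v w; simp [T, hQ v w]
  have hTρ : Tendsto (fun c => T (ρ c)) (𝓝 (Q : F →L[ℝ] F →L[ℝ] ℝ))
      (𝓝 (Q : F →L[ℝ] F →L[ℝ] ℝ)) := by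
    have : ContinuousAt (fun c => T (ρ c)) (Q : F →L[ℝ] F →L[ℝ] ℝ) :=
      (T.continuous.comp hρ.continuous).continuousAt
    simpa [ContinuousAt, hρQ, hTQ] using this
  filter_upwards [hSρ, hTρ.eventually hρS] with c h1 h2 hc v
  have hST : S (T (ρ c)) = c := by
    ext v w
    rw [hc v w]
    conv_rhs => rw [← h1]
    exact hq ((ρ c) w) _
  rw [hST] at h2
  have h3 : ∀ v w, ρ c v w = ρ c w v := fun v w => by
    conv_lhs => rw [h2]
    rfl
  conv_rhs => rw [← h1]
  simp only [ContinuousLinearEquiv.apply_symm_apply]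
  exact h3 _ _

/-- Morse lemma with parameters, at a fibrewise critical point with nondegenerate
fibrewise Hessian `A`. -/
theorem exists_contDiff_fibrewise_morse [FiniteDimensional ℝ E] [FiniteDimensional ℝ F]
    {φ : E × F → ℝ} (hφ : ContDiff ℝ ∞ φ)
    (hcrit : ∀ᶠ x in 𝓝 (0 : E), (fderiv ℝ φ (x, 0)).comp (.inr ℝ E F) = 0)
    {A : F →L[ℝ] F →L[ℝ] ℝ}
    (hA : HasFDerivAt (fun y => (fderiv ℝ φ (0, y)).comp (.inr ℝ E F)) A 0)
    (hsymm : ∀ v w, A v w = A w v) (hnd : ∀ v, (∀ w, A v w = 0) → v = 0) :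
    ∃ Θ : E × F → E × F, ContDiff ℝ ∞ Θ ∧ Θ 0 = 0 ∧
      HasFDerivAt Θ (ContinuousLinearMap.id ℝ (E × F)) 0 ∧ (∀ p, (Θ p).1 = p.1) ∧
      ∀ᶠ p in 𝓝 0, φ p = φ (p.1, 0) + (1 / 2) * A (Θ p).2 (Θ p).2 := by
  obtain ⟨a, ha, hφa⟩ := exists_contDiff_hadamard hφ
  obtain ⟨b, hb, hab⟩ := exists_contDiff_hadamard ha
  have hslice : ∀ x, ContDiff ℝ ∞ fun y => a (x, y) := fun x => ha.comp (by fun_prop)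
  have hslice' : ∀ x, ContDiff ℝ ∞ fun y => b (x, y) := fun x => hb.comp (by fun_prop)
  have hfib : ∀ x y, (fderiv ℝ φ (x, y)).comp (.inr ℝ E F) =
      fderiv ℝ (fun y => φ (x, 0) + a (x, y) y) y := fun x y => by
    have h1 := (hφ.differentiable (by simp) (x, y)).hasFDerivAt.comp y
      (hasFDerivAt_prodMk_right x y)
    rw [← h1.fderiv]
    congr 1
    exact funext fun y => hφa x y
  have ha0 : ∀ᶠ x in 𝓝 (0 : E), a (x, 0) = 0 := by
    filter_upwards [hcrit] with x hx
    rw [← hx, hfib, (hasFDerivAt_clm_apply_self (hslice x) _ 0).fderiv]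
    ext; simp
  have hfd : fderiv ℝ (fun y => a (0, y)) 0 = b (0, 0) := by
    rw [show (fun y => a (0, y)) = fun y => a (0, 0) + b (0, y) y from funext fun y => hab 0 y,
      (hasFDerivAt_clm_apply_self (hslice' 0) _ 0).fderiv]
    ext; simp
  have hAb : A = b (0, 0) + (b (0, 0)).flip := by
    simp only [hfib] at hA
    rw [hA.unique (hasFDerivAt_fderiv_clm_apply_self (hslice 0) _), hfd]
  obtain ⟨Q, hQ⟩ := exists_continuousLinearEquiv_of_injective ((1 / 2 : ℝ) • A)
    fun v hv => hnd v fun w => by simpa using hv w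
  have hQA : ∀ v w, Q v w = 1 / 2 * A v w := fun v w => by
    rw [← ContinuousLinearEquiv.coe_coe, hQ]; simp
  obtain ⟨ρ, hρ, hρQ, hρc⟩ := exists_contDiff_sqrt Q fun v w => by rw [hQA, hQA, hsymm]
  let C : E × F → F →L[ℝ] F →L[ℝ] ℝ := fun p => (1 / 2 : ℝ) • (b p + (b p).flip)
  have hC : ContDiff ℝ ∞ C :=
    (hb.add ((contDiff_clm_flip (F := F) (G := ℝ)).comp hb)).const_smul (1 / 2 : ℝ)
  have hC0 : C 0 = Q := by rw [hQ, hAb]; rfl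
  have hR : ContDiff ℝ ∞ fun p => ρ (C p) := hρ.comp hC
  let Θ : E × F → E × F := fun p => (p.1, Q.symm (ρ (C p) p.2))
  refine ⟨Θ, contDiff_fst.prodMk (Q.symm.contDiff.comp (hR.clm_apply contDiff_snd)), ?_, ?_,
    fun p => rfl, ?_⟩
  · simp [Θ]
  · have h1 : HasFDerivAt (fun p : E × F => ρ (C p) p.2) _ 0 :=
      (hR.differentiable (by simp) 0).hasFDerivAt.clm_apply hasFDerivAt_snd
    refine (hasFDerivAt_fst.prodMk (Q.symm.hasFDerivAt.comp 0 h1)).congr_fderiv ?_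
    ext v <;> simp [hC0, hρQ]
  · have h1 : Tendsto (fun p : E × F => p.1) (𝓝 0) (𝓝 0) := continuous_fst.tendsto' _ _ rfl
    have h2 : Tendsto C (𝓝 0) (𝓝 (Q : F →L[ℝ] F →L[ℝ] ℝ)) := hC.continuous.tendsto' _ _ hC0
    filter_upwards [h1.eventually ha0, h2.eventually hρc] with p hp hpC
    have h3 := hpC (fun v w => by simp [C, add_comm]) p.2
    rw [← hQA]
    simp only [Θ, h3]
    obtain ⟨x, y⟩ := p
    rw [hφa x y, hab x y, show a (x, 0) = 0 from hp]
    simp only [C, zero_add, smul_apply, add_apply,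
      ContinuousLinearMap.flip_apply, smul_eq_mul]
    ring

/-- The fibrewise critical point given by the implicit function theorem. -/
theorem exists_contDiff_fibrewise_critical [FiniteDimensional ℝ E] [FiniteDimensional ℝ F]
    {f : E × F → ℝ} (hf : ContDiff ℝ ∞ f) (hcrit : fderiv ℝ f 0 = 0)
    {B : (E × F) →L[ℝ] (E × F) →L[ℝ] ℝ} (hB : HasFDerivAt (fderiv ℝ f) B 0)
    (hsplit : ∀ u v, B (u, 0) (0, v) = 0) (hnd : ∀ v, (∀ w, B (0, v) (0, w) = 0) → v = 0) :
    ∃ η : E → F, ContDiff ℝ ∞ η ∧ η 0 = 0 ∧ HasFDerivAt η (0 : E →L[ℝ] F) 0 ∧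
      ∀ᶠ x in 𝓝 0, (fderiv ℝ f (x, η x)).comp (.inr ℝ E F) = 0 := by
  let r : ((E × F) →L[ℝ] ℝ) →L[ℝ] F →L[ℝ] ℝ := .precomp ℝ (.inr ℝ E F)
  obtain ⟨e, he⟩ := exists_continuousLinearEquiv_of_injective
    (r.comp (B.comp (.inr ℝ E F))) fun v hv => hnd v fun w => by simpa [r] using hv w
  have he' : ∀ v w, e v w = B (0, v) (0, w) := fun v w => by
    rw [← ContinuousLinearEquiv.coe_coe, he]; simp [r]
  have hsum : ∀ u v w, B (u, v) (0, w) = B (0, v) (0, w) := fun u v w => by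
    have : ((u, v) : E × F) = (u, 0) + (0, v) := by simp
    rw [this, map_add, add_apply, hsplit, zero_add]
  let Φ : E × F → E × (F →L[ℝ] ℝ) := fun p => (p.1, r (fderiv ℝ f p))
  have hΦ : ContDiff ℝ ∞ Φ :=
    contDiff_fst.prodMk (r.contDiff.comp (hf.fderiv_right (m := ∞) (by simp)))
  have hΦ' : HasFDerivAt Φ (((ContinuousLinearEquiv.refl ℝ E).prodCongr e :
      (E × F) ≃L[ℝ] E × (F →L[ℝ] ℝ)) : (E × F) →L[ℝ] E × (F →L[ℝ] ℝ)) 0 := by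
    refine (hasFDerivAt_fst.prodMk (r.hasFDerivAt.comp 0 hB)).congr_fderiv ?_
    refine ContinuousLinearMap.ext fun p => Prod.ext rfl (ContinuousLinearMap.ext fun w => ?_)
    exact (hsum p.1 p.2 w).trans (he' p.2 w).symm
  have hΦ0 : Φ 0 = 0 := by simp [Φ, hcrit]
  obtain ⟨k, hk, hkΦ, hΦk⟩ := exists_contDiff_local_inverse hΦ hΦ'
  have hk0 : k 0 = 0 := by simpa [hΦ0] using hkΦ.self_of_nhds
  rw [hΦ0] at hΦk
  let η : E → F := fun x => (k (x, 0)).2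
  have hη : ContDiff ℝ ∞ η := contDiff_snd.comp (hk.comp (by fun_prop))
  have hη0 : η 0 = 0 := congrArg Prod.snd hk0
  have hev : ∀ᶠ x in 𝓝 (0 : E), r (fderiv ℝ f (x, η x)) = 0 := by
    have h1 : Tendsto (fun x : E => (x, (0 : F →L[ℝ] ℝ))) (𝓝 0) (𝓝 0) :=
      Continuous.tendsto' (by fun_prop) _ _ rfl
    filter_upwards [h1.eventually hΦk] with x hx
    have h2 : (k (x, 0)).1 = x := congrArg Prod.fst hx
    have h3 : r (fderiv ℝ f (k (x, 0))) = 0 := congrArg Prod.snd hx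
    rwa [show k (x, 0) = (x, η x) from Prod.ext h2 rfl] at h3
  refine ⟨η, hη, hη0, ?_, hev⟩
  have hd := (hη.differentiable (by simp) 0).hasFDerivAt
  have h1 : HasFDerivAt (fun x => (x, η x)) _ (0 : E) := (hasFDerivAt_id 0).prodMk hd
  have hB' : HasFDerivAt (fderiv ℝ f) B ((0 : E), η 0) := by rwa [hη0]
  have h2 := (r.hasFDerivAt.comp (0 : E) (hB'.comp (0 : E) h1)).unique
    ((hasFDerivAt_const (0 : F →L[ℝ] ℝ) (0 : E)).congr_of_eventuallyEq hev)
  refine hd.congr_fderiv (ContinuousLinearMap.ext fun u => hnd _ fun w => ?_)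
  have h3 := DFunLike.congr_fun (DFunLike.congr_fun h2 u) w
  exact (hsum u _ w).symm.trans h3

/-- The function `x ↦ f (x, η x)` along the fibrewise critical points has the horizontal part
of the Hessian of `f` as its Hessian. -/
theorem fderiv_fderiv_along_fibrewise_critical {f : E × F → ℝ} (hf : ContDiff ℝ ∞ f)
    {B : (E × F) →L[ℝ] (E × F) →L[ℝ] ℝ} (hB : HasFDerivAt (fderiv ℝ f) B 0)
    {η : E → F} (hη : ContDiff ℝ ∞ η) (hη0 : η 0 = 0) (hη' : HasFDerivAt η (0 : E →L[ℝ] F) 0)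
    (hcrit : ∀ᶠ x in 𝓝 0, (fderiv ℝ f (x, η x)).comp (.inr ℝ E F) = 0) (u u' : E) :
    fderiv ℝ (fderiv ℝ fun x => f (x, η x)) 0 u u' = B (u, 0) (u', 0) := by
  let r : ((E × F) →L[ℝ] ℝ) →L[ℝ] E →L[ℝ] ℝ := .precomp ℝ (.inl ℝ E F)
  have h1 : fderiv ℝ (fun x => f (x, η x)) =ᶠ[𝓝 0] fun x => r (fderiv ℝ f (x, η x)) := by
    filter_upwards [hcrit] with x hx
    have h2 : HasFDerivAt (fun x => (x, η x)) _ x :=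
      (hasFDerivAt_id x).prodMk (hη.differentiable (by simp) x).hasFDerivAt
    have h3 : HasFDerivAt (fun x => f (x, η x)) _ x :=
      (hf.differentiable (by simp) (x, η x)).hasFDerivAt.comp x h2
    rw [h3.fderiv]
    ext w
    have h4 : fderiv ℝ f (x, η x) (0, fderiv ℝ η x w) = 0 := DFunLike.congr_fun hx _
    have h5 : ((w, fderiv ℝ η x w) : E × F) = (w, 0) + (0, fderiv ℝ η x w) := by simp
    change fderiv ℝ f (x, η x) (w, fderiv ℝ η x w) = fderiv ℝ f (x, η x) (w, 0)
    rw [h5, map_add, h4, add_zero]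
  have h2 : HasFDerivAt (fun x => (x, η x)) _ (0 : E) := (hasFDerivAt_id 0).prodMk hη'
  have hB' : HasFDerivAt (fderiv ℝ f) B ((0 : E), η 0) := by rwa [hη0]
  have h3 : HasFDerivAt (fun x => r (fderiv ℝ f (x, η x))) _ 0 :=
    r.hasFDerivAt.comp (0 : E) (hB'.comp (0 : E) h2)
  rw [h1.fderiv_eq, h3.fderiv]
  rfl

theorem fderiv_half_quadratic (A : F →L[ℝ] F →L[ℝ] ℝ) :
    fderiv ℝ (fun y => 1 / 2 * A y y) 0 = 0 := by
  have h := (hasFDerivAt_clm_apply_self ((1 / 2 : ℝ) • A).contDiff 0 0).fderiv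
  simpa using h

theorem fderiv_fderiv_half_quadratic {A : F →L[ℝ] F →L[ℝ] ℝ} (hA : ∀ v w, A v w = A w v)
    (v w : F) : fderiv ℝ (fderiv ℝ fun y => 1 / 2 * A y y) 0 v w = A v w := by
  have h := (hasFDerivAt_fderiv_clm_apply_self ((1 / 2 : ℝ) • A).contDiff 0).fderiv
  rw [ContinuousLinearMap.fderiv] at h
  have h' := DFunLike.congr_fun (DFunLike.congr_fun h v) w
  simp only [add_apply, smul_apply, ContinuousLinearMap.flip_apply, smul_eq_mul, zero_add,
    hA w v] at h'
  rw [h']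
  ring

/-- The normal form in the splitting lemma, with fibrewise critical points `η` and vertical
Hessian `A`. -/
theorem exists_contDiff_splitting [FiniteDimensional ℝ E] [FiniteDimensional ℝ F]
    {f : E × F → ℝ} (hf : ContDiff ℝ ∞ f)
    {η : E → F} (hη : ContDiff ℝ ∞ η) (hη0 : η 0 = 0) (hη' : HasFDerivAt η (0 : E →L[ℝ] F) 0)
    (hcrit : ∀ᶠ x in 𝓝 0, (fderiv ℝ f (x, η x)).comp (.inr ℝ E F) = 0)
    {A : F →L[ℝ] F →L[ℝ] ℝ}
    (hA : HasFDerivAt (fun y => (fderiv ℝ f (0, y)).comp (.inr ℝ E F)) A 0)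
    (hsymm : ∀ v w, A v w = A w v) (hnd : ∀ v, (∀ w, A v w = 0) → v = 0) :
    ∃ (U : Set (E × F)) (Ψ : E × F → E × F), IsOpen U ∧ 0 ∈ U ∧ ContDiff ℝ ∞ Ψ ∧ InjOn Ψ U ∧
      Ψ 0 = 0 ∧ HasFDerivAt Ψ (ContinuousLinearMap.id ℝ (E × F)) 0 ∧
      ∀ p ∈ U, f (Ψ p) = f (p.1, η p.1) + 1 / 2 * A p.2 p.2 := by
  let T : E × F → E × F := fun p => (p.1, η p.1 + p.2)
  have hT : ContDiff ℝ ∞ T := contDiff_fst.prodMk ((hη.comp contDiff_fst).add contDiff_snd)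
  have hT' : ∀ p, HasFDerivAt T ((ContinuousLinearMap.fst ℝ E F).prod
      ((fderiv ℝ η p.1).comp (.fst ℝ E F) + .snd ℝ E F)) p := fun p =>
    hasFDerivAt_fst.prodMk
      (((hη.differentiable (by simp) p.1).hasFDerivAt.comp p hasFDerivAt_fst).add hasFDerivAt_snd)
  have hT0 : HasFDerivAt T (ContinuousLinearMap.id ℝ (E × F)) 0 := by
    refine (hT' 0).congr_fderiv ?_
    ext v <;> simp [hη'.fderiv]
  have hTinj : Function.Injective T := fun p q hpq => by
    obtain ⟨h1, h2⟩ := Prod.ext_iff.1 hpq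
    simp only [T] at h1 h2
    rw [h1] at h2
    exact Prod.ext h1 (add_left_cancel h2)
  have hφ : ContDiff ℝ ∞ fun p => f (T p) := hf.comp hT
  have hφ' : ∀ p, (fderiv ℝ (fun p => f (T p)) p).comp (.inr ℝ E F) =
      (fderiv ℝ f (T p)).comp (.inr ℝ E F) := fun p => by
    have h : HasFDerivAt (fun p => f (T p)) _ p :=
      (hf.differentiable (by simp) (T p)).hasFDerivAt.comp p (hT' p)
    rw [h.fderiv]
    ext v
    simp
  obtain ⟨Θ, hΘ, hΘ0, hΘ', hΘ1, hfΘ⟩ := exists_contDiff_fibrewise_morse hφ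
    (by simpa only [hφ', T, add_zero] using hcrit)
    (by simpa only [hφ', T, hη0, zero_add] using hA) hsymm hnd
  obtain ⟨k, hk, hkΘ, hΘk⟩ := exists_contDiff_local_inverse hΘ
    (f' := ContinuousLinearEquiv.refl ℝ (E × F)) hΘ'
  rw [hΘ0] at hΘk
  have hk0 : k 0 = 0 := by simpa only [hΘ0] using hkΘ.self_of_nhds
  have hk' : HasFDerivAt k (ContinuousLinearMap.id ℝ (E × F)) 0 := by
    have hd : HasFDerivAt k (fderiv ℝ k 0) 0 := (hk.differentiable (by simp) 0).hasFDerivAt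
    have hd' : HasFDerivAt k (fderiv ℝ k 0) (Θ 0) := by rwa [hΘ0]
    have h1 := (hd'.comp 0 hΘ').unique ((hasFDerivAt_id 0).congr_of_eventuallyEq hkΘ)
    rw [ContinuousLinearMap.comp_id] at h1
    rwa [← h1]
  have hkt : Tendsto k (𝓝 0) (𝓝 0) := hk.continuous.tendsto' _ _ hk0
  obtain ⟨U, hU, hUo, h0U⟩ := eventually_nhds_iff.1 (hΘk.and (hkt.eventually hfΘ))
  refine ⟨U, fun p => T (k p), hUo, h0U, hT.comp hk, fun p hp q hq hpq => ?_, ?_, ?_,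
    fun p hp => ?_⟩
  · rw [← (hU p hp).1, hTinj hpq, (hU q hq).1]
  · simp [T, hk0, hη0]
  · have hT0' : HasFDerivAt T (ContinuousLinearMap.id ℝ (E × F)) (k 0) := by rwa [hk0]
    exact hT0'.comp 0 hk'
  · obtain ⟨h1, h2⟩ := hU p hp
    have h3 : (k p).1 = p.1 := by rw [← hΘ1, h1]
    rw [h1, h3] at h2
    simpa only [T, add_zero] using h2

end SplittingLemma

/-- Gromoll–Meyer Splitting Lemma.  Let `f : ℝ^{n₁} × ℝ^{n₂} → ℝ` be smooth with
`(0,0)` an isolated critical point.  If the second derivative `B = D²f(0,0)` preserves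
the splitting (`B (u,0) (0,v) = 0`) and its kernel is contained in `ℝ^{n₁} × {0}`,
then there are a neighborhood `U` of the origin, a smooth injective map `Ψ` on `U`
with `Ψ(0,0) = (0,0)`, `DΨ(0,0) = id`, and smooth `g, h` with
`f (Ψ (z₁,z₂)) = g z₁ + h z₂` on `U`, `0` a nondegenerate critical point of `h`,
`D²g(0)` the restriction of `B` to `ℝ^{n₁} × 0`, and `D²h(0)` the restriction of `B`
to `0 × ℝ^{n₂}`. -/
theorem stmt6 {n₁ n₂ : ℕ} (f : Eu n₁ × Eu n₂ → ℝ) (hf : ContDiff ℝ (⊤ : ℕ∞) f)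
    (hcrit : fderiv ℝ f (0, 0) = 0)
    (hiso : ∃ V ∈ nhds ((0, 0) : Eu n₁ × Eu n₂),
      ∀ p ∈ V, fderiv ℝ f p = 0 → p = (0, 0))
    (B : (Eu n₁ × Eu n₂) →L[ℝ] (Eu n₁ × Eu n₂) →L[ℝ] ℝ)
    (hB : B = fderiv ℝ (fderiv ℝ f) (0, 0))
    (hsplit : ∀ (u : Eu n₁) (v : Eu n₂), B (u, 0) (0, v) = 0)
    (hker : ∀ w : Eu n₁ × Eu n₂, (∀ w', B w w' = 0) → w.2 = 0) :
    ∃ (U : Set (Eu n₁ × Eu n₂)) (Ψ : Eu n₁ × Eu n₂ → Eu n₁ × Eu n₂)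
      (g : Eu n₁ → ℝ) (h : Eu n₂ → ℝ),
      IsOpen U ∧ ((0, 0) : Eu n₁ × Eu n₂) ∈ U ∧
      ContDiffOn ℝ (⊤ : ℕ∞) Ψ U ∧ Set.InjOn Ψ U ∧
      Ψ (0, 0) = (0, 0) ∧
      fderiv ℝ Ψ (0, 0) = ContinuousLinearMap.id ℝ (Eu n₁ × Eu n₂) ∧
      ContDiff ℝ (⊤ : ℕ∞) g ∧ ContDiff ℝ (⊤ : ℕ∞) h ∧
      (∀ p ∈ U, f (Ψ p) = g p.1 + h p.2) ∧
      fderiv ℝ h 0 = 0 ∧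
      (∀ v : Eu n₂, (∀ v', fderiv ℝ (fderiv ℝ h) 0 v v' = 0) → v = 0) ∧
      (∀ u u' : Eu n₁, fderiv ℝ (fderiv ℝ g) 0 u u' = B (u, 0) (u', 0)) ∧
      (∀ v v' : Eu n₂, fderiv ℝ (fderiv ℝ h) 0 v v' = B (0, v) (0, v')) := by
  rw [Prod.mk_zero_zero] at hcrit hB
  have hB' : HasFDerivAt (fderiv ℝ f) B 0 := by
    rw [hB]
    exact ((hf.fderiv_right (m := (⊤ : ℕ∞)) (by simp)).differentiable (by simp) 0).hasFDerivAt
  have hsymm : ∀ v w, B v w = B w v := fun v w => by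
    rw [hB]
    exact hf.contDiffAt.isSymmSndFDerivAt
      (by simpa using WithTop.coe_le_coe.2 (le_top : (2 : ℕ∞) ≤ ⊤)) v w
  have hnd : ∀ v : Eu n₂, (∀ w : Eu n₂, B (0, v) (0, w) = 0) → v = 0 := fun v hv =>
    hker (0, v) fun w' => by
      rw [show w' = (w'.1, 0) + (0, w'.2) by simp, map_add, hsymm, hsplit, hv, zero_add]
  obtain ⟨η, hη, hη0, hη', hcrit'⟩ := exists_contDiff_fibrewise_critical hf hcrit hB' hsplit hnd
  let r : ((Eu n₁ × Eu n₂) →L[ℝ] ℝ) →L[ℝ] Eu n₂ →L[ℝ] ℝ := .precomp ℝ (.inr ℝ _ _)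
  let A : Eu n₂ →L[ℝ] Eu n₂ →L[ℝ] ℝ := r.comp (B.comp (.inr ℝ _ _))
  have hA : HasFDerivAt (fun y => (fderiv ℝ f (0, y)).comp (.inr ℝ _ _)) A 0 :=
    r.hasFDerivAt.comp (0 : Eu n₂)
      (HasFDerivAt.comp (0 : Eu n₂) hB' (hasFDerivAt_prodMk_right (0 : Eu n₁) (0 : Eu n₂)))
  have hAsymm : ∀ v w, A v w = A w v := fun v w => hsymm (0, v) (0, w)
  obtain ⟨U, Ψ, hUo, h0U, hΨ, hinj, hΨ0, hΨ', hfΨ⟩ :=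
    exists_contDiff_splitting hf hη hη0 hη' hcrit' hA hAsymm hnd
  exact ⟨U, Ψ, fun x => f (x, η x), fun y => 1 / 2 * A y y, hUo, h0U, hΨ.contDiffOn, hinj, hΨ0,
    hΨ'.fderiv, hf.comp (contDiff_id.prodMk hη),
    contDiff_const.mul (A.contDiff.clm_apply contDiff_id), hfΨ, fderiv_half_quadratic A,
    fun v hv => hnd v fun w => (fderiv_fderiv_half_quadratic hAsymm v w).symm.trans (hv w),
    fderiv_fderiv_along_fibrewise_critical hf hB' hη hη0 hη' hcrit',
    fderiv_fderiv_half_quadratic hAsymm⟩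
end

section
/- (Invariant Gromoll–Meyer Splitting Lemma.) Let f : ℝ^{n₁} × ℝ^{n₂} → ℝ be a smooth function such that (0,0) is an isolated critical point, D²f(0,0)((u,0),(0,v)) = 0 for all u, v, and the kernel of the bilinear form D²f(0,0) is contained in ℝ^{n₁} × {0}. Let A₁ and A₂ be linear isometries of ℝ^{n₁} and ℝ^{n₂} respectively (with respect to the Euclidean inner products), set A(z₁,z₂) = (A₁z₁, A₂z₂), and assume f is A-invariant: f(Az) = f(z) for all z. Then there exist an open neighborhood U of (0,0) with A(U) = U, a smooth injective map Ψ : U → ℝ^{n₁} × ℝ^{n₂} with Ψ(0,0) = (0,0), DΨ(0,0) = id, and Ψ(Az) = A(Ψ(z)) for all z ∈ U, and smooth functions g : ℝ^{n₁} → ℝ, h : ℝ^{n₂} → ℝ such that f(Ψ(z₁,z₂)) = g(z₁) + h(z₂) on U and 0 ∈ ℝ^{n₂} is a nondegenerate critical point of h. -/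
open Filter Topology Set
open scoped ContDiff

section Prelim
set_option maxSynthPendingDepth 3
universe u

variable {E : Type u} [NormedAddCommGroup E] [NormedSpace ℝ E]

/-- Local inverse of a smooth map tangent to the identity, smooth on a whole neighborhood. -/
theorem exists_smooth_local_inverse [CompleteSpace E] {G : E → E}
    (hG : ∀ᶠ z in 𝓝 0, ContDiffAt ℝ ∞ G z) (h0 : G 0 = 0)
    (hd : HasFDerivAt G (ContinuousLinearMap.id ℝ E) 0) :
    ∃ H : E → E, H 0 = 0 ∧ (∀ᶠ z in 𝓝 0, ContDiffAt ℝ ∞ H z) ∧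
      HasFDerivAt H (ContinuousLinearMap.id ℝ E) 0 ∧
      (∀ᶠ z in 𝓝 0, G (H z) = z) ∧ (∀ᶠ z in 𝓝 0, H (G z) = z) := by
  have hn : (∞ : ℕ∞ω) ≠ 0 := by simp
  have hd' : HasFDerivAt G ((ContinuousLinearEquiv.refl ℝ E : E ≃L[ℝ] E) : E →L[ℝ] E) 0 := hd
  let e := hG.self_of_nhds.toOpenPartialHomeomorph G hd' hn
  have hes : (0 : E) ∈ e.source :=
    hG.self_of_nhds.mem_toOpenPartialHomeomorph_source hd' hn
  have heG : ∀ z, e z = G z := fun _ => rfl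
  have het : (0 : E) ∈ e.target := by
    have := e.map_source hes
    rwa [heG, h0] at this
  have hs0 : e.symm 0 = 0 := by
    have := e.left_inv hes
    rwa [heG, h0] at this
  have hcont : Tendsto e.symm (𝓝 0) (𝓝 0) := by
    have := e.continuousAt_symm het
    rwa [ContinuousAt, hs0] at this
  have hinv : ∀ᶠ z in 𝓝 (0 : E),
      fderiv ℝ G z ∈ range ((↑) : (E ≃L[ℝ] E) → (E →L[ℝ] E)) := by
    have hc : ContinuousAt (fderiv ℝ G) 0 :=
      (hG.self_of_nhds.fderiv_right (m := 0) (by simp)).continuousAt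
    refine hc ?_
    rw [hd'.fderiv]
    exact ContinuousLinearEquiv.nhds _
  have hGe : ∀ᶠ z in 𝓝 (0 : E), e (e.symm z) = z := by
    filter_upwards [e.open_target.mem_nhds het] with z hz using e.right_inv hz
  refine ⟨e.symm, hs0, ?_, ?_, hGe, ?_⟩
  · filter_upwards [e.open_target.mem_nhds het, hcont.eventually hG, hcont.eventually hinv]
      with z hz h1 ⟨L, hL⟩
    refine e.contDiffAt_symm (f₀' := L) hz ?_ h1
    rw [hL]
    exact (h1.differentiableAt (by simp)).hasFDerivAt
  · exact HasFDerivAt.of_local_left_inverse (f := G) (f' := ContinuousLinearEquiv.refl ℝ E)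
      (e.continuousAt_symm het) (by rwa [hs0]) hGe
  · filter_upwards [e.open_source.mem_nhds hes] with z hz using e.left_inv hz

/-- A local inverse commutes with every linear map the original map commutes with. -/
theorem local_inverse_comm {G H : E → E} (hH0 : H 0 = 0) (hH : ContinuousAt H 0)
    (hGH : ∀ᶠ z in 𝓝 0, G (H z) = z) (hHG : ∀ᶠ z in 𝓝 0, H (G z) = z)
    (A : E →L[ℝ] E) (hA : ∀ᶠ z in 𝓝 0, G (A z) = A (G z)) :
    ∀ᶠ z in 𝓝 0, H (A z) = A (H z) := by
  have hH' : Tendsto H (𝓝 0) (𝓝 0) := by rwa [ContinuousAt, hH0] at hH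
  have hA' : Tendsto A (𝓝 0) (𝓝 0) := by simpa using A.continuous.tendsto 0
  filter_upwards [hGH, hH'.eventually hA, (hA'.comp hH').eventually hHG] with z h1 h2 h3
  simp only [Function.comp_apply] at h3
  rw [← h3, h2, h1]

/-- A germ of a smooth function extends to a globally smooth function. -/
theorem exists_contDiff_eventuallyEq_s7 [FiniteDimensional ℝ E] {g₀ : E → ℝ}
    (hg : ∀ᶠ x in 𝓝 0, ContDiffAt ℝ ∞ g₀ x) :
    ∃ g : E → ℝ, ContDiff ℝ ∞ g ∧ ∀ᶠ x in 𝓝 0, g x = g₀ x := by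
  obtain ⟨r, hr, hball⟩ := Metric.eventually_nhds_iff_ball.1 hg
  let χ : ContDiffBump (0 : E) := ⟨r / 4, r / 2, by positivity, by linarith⟩
  refine ⟨fun x => χ x * g₀ x, contDiff_iff_contDiffAt.2 fun x => ?_, ?_⟩
  · by_cases hx : x ∈ Metric.ball (0 : E) r
    · exact χ.contDiffAt.mul (hball x hx)
    · have hx' : x ∉ tsupport χ := by
        rw [χ.tsupport_eq]
        simp only [Metric.mem_ball, Metric.mem_closedBall, not_lt, not_le] at hx ⊢
        change r / 2 < _
        linarith
      have : (fun x => χ x * g₀ x) =ᶠ[𝓝 x] fun _ => 0 := by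
        filter_upwards [notMem_tsupport_iff_eventuallyEq.1 hx'] with y hy
        simp [hy]
      exact contDiffAt_const.congr_of_eventuallyEq this
  · filter_upwards [χ.eventuallyEq_one] with x hx
    simp [hx]

/-- Differentiation under the integral over `[0, 1]` of a jointly smooth function. -/
theorem hasFDerivAt_integral_param [FiniteDimensional ℝ E]
    {F : Type u} [NormedAddCommGroup F] [NormedSpace ℝ F]
    {k : E × ℝ → F} (hk : ContDiff ℝ ∞ k) (p : E) :
    HasFDerivAt (fun p => ∫ t in (0 : ℝ)..1, k (p, t))
      (∫ t in (0 : ℝ)..1, (fderiv ℝ k (p, t)).comp (ContinuousLinearMap.inl ℝ E ℝ)) p := by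
  have : ProperSpace E := FiniteDimensional.proper ℝ E
  have hk' : Continuous fun q : E × ℝ =>
      (fderiv ℝ k q).comp (ContinuousLinearMap.inl ℝ E ℝ) :=
    (hk.continuous_fderiv (by simp)).clm_comp continuous_const
  obtain ⟨C, hC⟩ := ((isCompact_closedBall p 1).prod
    (isCompact_Icc (a := (0 : ℝ)) (b := 1))).exists_bound_of_continuousOn hk'.continuousOn
  refine intervalIntegral.hasFDerivAt_integral_of_dominated_of_fderiv_le
    (F' := fun p t => (fderiv ℝ k (p, t)).comp (ContinuousLinearMap.inl ℝ E ℝ))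
    (bound := fun _ => C) (Metric.closedBall_mem_nhds p one_pos) ?_ ?_ ?_ ?_ ?_ ?_
  · exact Eventually.of_forall fun q =>
      (hk.continuous.comp (Continuous.prodMk_right q)).aestronglyMeasurable
  · exact (hk.continuous.comp (Continuous.prodMk_right p)).intervalIntegrable _ _
  · exact (hk'.comp (Continuous.prodMk_right p)).aestronglyMeasurable
  · refine Eventually.of_forall fun t ht q hq => hC (q, t) ⟨hq, ?_⟩
    rw [uIoc_of_le zero_le_one] at ht
    exact Ioc_subset_Icc_self ht
  · exact intervalIntegrable_const
  · exact Eventually.of_forall fun t _ q _ =>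
      (hk.differentiable (by simp) (q, t)).hasFDerivAt.comp q (hasFDerivAt_prodMk_left q t)

/-- Smoothness of an integral over `[0, 1]` depending smoothly on a parameter. -/
theorem contDiff_integral_param [FiniteDimensional ℝ E]
    {F : Type u} [NormedAddCommGroup F] [NormedSpace ℝ F]
    {k : E × ℝ → F} (hk : ContDiff ℝ ∞ k) :
    ContDiff ℝ ∞ fun p => ∫ t in (0 : ℝ)..1, k (p, t) := by
  refine contDiff_infty.2 fun n => ?_
  induction n generalizing F with
  | zero =>
    exact contDiff_zero.2 (Differentiable.continuous (𝕜 := ℝ) fun p =>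
      (hasFDerivAt_integral_param hk p).differentiableAt)
  | succ n ih =>
    push_cast
    refine contDiff_succ_iff_fderiv.2
      ⟨fun p => (hasFDerivAt_integral_param hk p).differentiableAt, by simp, ?_⟩
    rw [funext fun p => (hasFDerivAt_integral_param hk p).fderiv]
    exact ih ((hk.fderiv_right (m := ∞) (by simp)).clm_comp contDiff_const)

/-- Second-order Taylor formula on `[0, 1]` with integral remainder. -/
theorem taylor_two_integral {ψ ψ' ψ'' : ℝ → ℝ} (h1 : ∀ t, HasDerivAt ψ (ψ' t) t)
    (h2 : ∀ t, HasDerivAt ψ' (ψ'' t) t) (hc : Continuous ψ'') :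
    ψ 1 = ψ 0 + ψ' 0 + ∫ t in (0 : ℝ)..1, (1 - t) * ψ'' t := by
  have := intervalIntegral.integral_eq_sub_of_hasDerivAt (a := 0) (b := 1)
    (f := fun t => (1 - t) * ψ' t + ψ t) (f' := fun t => (1 - t) * ψ'' t) (fun t _ => by
      convert! (((hasDerivAt_id t).const_sub 1).mul (h2 t)).add (h1 t) using 1
      simp) (by apply Continuous.intervalIntegrable; fun_prop)
  rw [this]
  simp only [sub_self, zero_mul, zero_add, sub_zero, one_mul]
  ring

variable {E₁ E₂ : Type u} [NormedAddCommGroup E₁] [NormedSpace ℝ E₁]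
  [NormedAddCommGroup E₂] [NormedSpace ℝ E₂]

/-- The second partial derivative of `f` in the second variable. -/
noncomputable def hessSnd (f : E₁ × E₂ → ℝ) (p : E₁ × E₂) : E₂ →L[ℝ] E₂ →L[ℝ] ℝ :=
  (fderiv ℝ (fderiv ℝ f) p).bilinearComp (ContinuousLinearMap.inr ℝ E₁ E₂)
    (ContinuousLinearMap.inr ℝ E₁ E₂)

theorem hessSnd_apply (f : E₁ × E₂ → ℝ) (p : E₁ × E₂) (u v : E₂) :
    hessSnd f p u v = fderiv ℝ (fderiv ℝ f) p (0, u) (0, v) := rfl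

theorem contDiff_hessSnd [FiniteDimensional ℝ E₂] {f : E₁ × E₂ → ℝ} (hf : ContDiff ℝ ∞ f) :
    ContDiff ℝ ∞ (hessSnd f) := by
  have h2 : ContDiff ℝ ∞ (fderiv ℝ (fderiv ℝ f)) :=
    (hf.fderiv_right (m := ∞) (by simp)).fderiv_right (by simp)
  refine contDiff_clm_apply_iff.2 fun u => contDiff_clm_apply_iff.2 fun v => ?_
  exact (h2.clm_apply contDiff_const).clm_apply contDiff_const

/-- The integral remainder in the second-order Taylor formula in the second variable. -/
noncomputable def taylorSnd (f : E₁ × E₂ → ℝ) (q : (E₁ × E₂) × E₂) : E₂ →L[ℝ] E₂ →L[ℝ] ℝ :=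
  ∫ t in (0 : ℝ)..1, (1 - t) • hessSnd f (q.1 + t • ((0 : E₁), q.2))

theorem contDiff_taylorSnd [FiniteDimensional ℝ E₁] [FiniteDimensional ℝ E₂]
    {f : E₁ × E₂ → ℝ} (hf : ContDiff ℝ ∞ f) : ContDiff ℝ ∞ (taylorSnd f) := by
  refine contDiff_integral_param
    (k := fun r : ((E₁ × E₂) × E₂) × ℝ =>
      (1 - r.2) • hessSnd f (r.1.1 + r.2 • ((0 : E₁), r.1.2))) ?_
  exact (contDiff_const.sub contDiff_snd).smul ((contDiff_hessSnd hf).comp (by fun_prop))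

theorem taylorSnd_apply [FiniteDimensional ℝ E₂] {f : E₁ × E₂ → ℝ} (hf : ContDiff ℝ ∞ f)
    (p : E₁ × E₂) (y u v : E₂) :
    taylorSnd f (p, y) u v =
      ∫ t in (0 : ℝ)..1, (1 - t) * hessSnd f (p + t • ((0 : E₁), y)) u v := by
  have hc : Continuous fun t : ℝ => (1 - t) • hessSnd f (p + t • ((0 : E₁), y)) := by
    have := (contDiff_hessSnd hf).continuous
    fun_prop
  have hc' : Continuous fun t : ℝ => (1 - t) • hessSnd f (p + t • ((0 : E₁), y)) u := by
    have := (contDiff_hessSnd hf).continuous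
    fun_prop
  rw [taylorSnd, ContinuousLinearMap.intervalIntegral_apply (hc.intervalIntegrable _ _)]
  simp only [smul_apply]
  rw [ContinuousLinearMap.intervalIntegral_apply (hc'.intervalIntegrable _ _)]
  simp

theorem taylorSnd_zero [FiniteDimensional ℝ E₂] {f : E₁ × E₂ → ℝ} (hf : ContDiff ℝ ∞ f)
    (p : E₁ × E₂) (u v : E₂) : taylorSnd f (p, 0) u v = 1 / 2 * hessSnd f p u v := by
  have : ∫ t in (0 : ℝ)..1, (1 - t) = 1 / 2 := by
    rw [intervalIntegral.integral_sub (by simp) (by simp)]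
    norm_num
  rw [taylorSnd_apply hf]
  simp only [Prod.mk_zero_zero, smul_zero, add_zero]
  rw [intervalIntegral.integral_mul_const, this]

theorem taylor_snd [FiniteDimensional ℝ E₂] {f : E₁ × E₂ → ℝ} (hf : ContDiff ℝ ∞ f)
    (p : E₁ × E₂) (y : E₂) :
    f (p + (0, y)) = f p + fderiv ℝ f p (0, y) + taylorSnd f (p, y) y y := by
  have h2 : ContDiff ℝ ∞ (fderiv ℝ f) := hf.fderiv_right (by simp)
  have hl : ∀ t : ℝ, HasDerivAt (fun t : ℝ => p + t • ((0 : E₁), y)) ((0 : E₁), y) t := fun t => by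
    simpa using ((hasDerivAt_id t).smul_const ((0 : E₁), y)).const_add p
  have := taylor_two_integral (ψ := fun t => f (p + t • ((0 : E₁), y)))
    (ψ' := fun t => fderiv ℝ f (p + t • ((0 : E₁), y)) (0, y))
    (ψ'' := fun t => hessSnd f (p + t • ((0 : E₁), y)) y y)
    (fun t => (hf.differentiable (by simp) _).hasFDerivAt.comp_hasDerivAt t (hl t))
    (fun t => by
      have h3 := (h2.differentiable (by simp) _).hasFDerivAt.comp_hasDerivAt t (hl t)
      simpa [hessSnd_apply] using h3.clm_apply (hasDerivAt_const t ((0 : E₁), y)))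
    (by have := (contDiff_hessSnd hf).continuous
        fun_prop)
  rw [taylorSnd_apply hf, ← show p + (1 : ℝ) • ((0 : E₁), y) = p + (0, y) by simp]
  simpa using this


theorem fderiv_of_invariant {f : E → ℝ} (hf : ContDiff ℝ ∞ f) {A : E →L[ℝ] E}
    (hA : ∀ z, f (A z) = f z) (p u : E) : fderiv ℝ f (A p) (A u) = fderiv ℝ f p u := by
  have h := (hf.differentiable (by simp) (A p)).hasFDerivAt.comp p A.hasFDerivAt
  rw [show f ∘ A = f from funext hA] at h
  rw [h.fderiv]
  rfl

theorem fderiv_fderiv_of_invariant {f : E → ℝ} (hf : ContDiff ℝ ∞ f) {A : E →L[ℝ] E}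
    (hA : ∀ z, f (A z) = f z) (p u v : E) :
    fderiv ℝ (fderiv ℝ f) (A p) (A u) (A v) = fderiv ℝ (fderiv ℝ f) p u v := by
  have h2 : Differentiable ℝ (fderiv ℝ f) :=
    (hf.fderiv_right (m := ∞) (by simp)).differentiable (by simp)
  have h := ((h2 (A p)).hasFDerivAt.comp p A.hasFDerivAt).clm_apply
    (hasFDerivAt_const (A v) p)
  have h' := (h2 p).hasFDerivAt.clm_apply (hasFDerivAt_const v p)
  simp only [Function.comp_apply, fderiv_of_invariant hf hA] at h
  have := DFunLike.congr_fun (h.unique h') u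
  simpa using this

section Invariant

variable {f : E₁ × E₂ → ℝ} {A₁ : E₁ →L[ℝ] E₁} {A₂ : E₂ →L[ℝ] E₂}

theorem hessSnd_of_invariant (hf : ContDiff ℝ ∞ f) (hA : ∀ z, f (A₁.prodMap A₂ z) = f z)
    (p : E₁ × E₂) (u v : E₂) :
    hessSnd f (A₁.prodMap A₂ p) (A₂ u) (A₂ v) = hessSnd f p u v := by
  simpa [hessSnd_apply] using fderiv_fderiv_of_invariant hf hA p (0, u) (0, v)

theorem taylorSnd_of_invariant [FiniteDimensional ℝ E₂] (hf : ContDiff ℝ ∞ f)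
    (hA : ∀ z, f (A₁.prodMap A₂ z) = f z) (p : E₁ × E₂) (y u v : E₂) :
    taylorSnd f (A₁.prodMap A₂ p, A₂ y) (A₂ u) (A₂ v) = taylorSnd f (p, y) u v := by
  simp only [taylorSnd_apply hf]
  congr 1 with t
  rw [← hessSnd_of_invariant hf hA (p + t • ((0 : E₁), y)) u v, map_add, map_smul]
  simp

theorem hessSnd_symm (hf : ContDiff ℝ ∞ f) (p : E₁ × E₂) (u v : E₂) :
    hessSnd f p u v = hessSnd f p v u :=
  (hf.contDiffAt.isSymmSndFDerivAt (by
    rw [minSmoothness_of_isRCLikeNormedField]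
    exact ENat.LEInfty.out)).eq _ _

theorem taylorSnd_symm [FiniteDimensional ℝ E₂] (hf : ContDiff ℝ ∞ f) (p : E₁ × E₂)
    (y u v : E₂) : taylorSnd f (p, y) u v = taylorSnd f (p, y) v u := by
  simp only [taylorSnd_apply hf]
  congr 1 with t
  rw [hessSnd_symm hf]

/-- The inverse of an invariant nondegenerate form is equivariant. -/
theorem form_inverse_equivariant {b : E₂ →L[ℝ] E₂ →L[ℝ] ℝ} {J : (E₂ →L[ℝ] ℝ) →L[ℝ] E₂}
    (hbJ : ∀ l, b (J l) = l) (hJb : ∀ v, J (b v) = v) (hs : Function.Surjective A₂)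
    (hb : ∀ u v, b (A₂ u) (A₂ v) = b u v) {l m : E₂ →L[ℝ] ℝ} (h : ∀ v, m (A₂ v) = l v) :
    J m = A₂ (J l) := by
  rw [← hJb (A₂ (J l))]
  congr 1
  ext w
  obtain ⟨v, rfl⟩ := hs w
  rw [hb, hbJ, h]

/-- The critical points of `f` along the second factor form, near the origin, an equivariant
graph tangent to the first factor. -/
theorem exists_critical_graph [CompleteSpace E₁] [CompleteSpace E₂] (hf : ContDiff ℝ ∞ f)
    (h0 : fderiv ℝ f 0 = 0) (hsplit : ∀ u v, fderiv ℝ (fderiv ℝ f) 0 (u, 0) (0, v) = 0)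
    {J : (E₂ →L[ℝ] ℝ) →L[ℝ] E₂} (hbJ : ∀ l, hessSnd f 0 (J l) = l)
    (hJb : ∀ v, J (hessSnd f 0 v) = v) (hs : Function.Surjective A₂)
    (hA : ∀ z, f (A₁.prodMap A₂ z) = f z) :
    ∃ φ : E₁ → E₂, φ 0 = 0 ∧ (∀ᶠ x in 𝓝 0, ContDiffAt ℝ ∞ φ x) ∧
      HasFDerivAt φ (0 : E₁ →L[ℝ] E₂) 0 ∧
      (∀ᶠ x in 𝓝 0, ∀ v, fderiv ℝ f (x, φ x) (0, v) = 0) ∧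
      (∀ᶠ x in 𝓝 0, φ (A₁ x) = A₂ (φ x)) := by
  have h2 : ContDiff ℝ ∞ (fderiv ℝ f) := hf.fderiv_right (by simp)
  let ι := ContinuousLinearMap.inr ℝ E₁ E₂
  let G : E₁ × E₂ → E₁ × E₂ := fun z => (z.1, J ((fderiv ℝ f z).comp ι))
  have hG : ContDiff ℝ ∞ G :=
    contDiff_fst.prodMk (J.contDiff.comp (h2.clm_comp contDiff_const))
  have hG0 : G 0 = 0 := by simp [G, h0]
  have hGd : HasFDerivAt G (ContinuousLinearMap.id ℝ _) 0 := by
    have h3 := (J.hasFDerivAt.comp (0 : E₁ × E₂)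
      ((h2.differentiable (by simp) 0).hasFDerivAt.clm_comp (hasFDerivAt_const ι 0)))
    have h4 := (hasFDerivAt_fst (𝕜 := ℝ) (p := (0 : E₁ × E₂))).prodMk h3
    convert! h4 using 1
    ext1
    · ext u
      · simp
      · have h5 : (fderiv ℝ (fderiv ℝ f) 0 (u, 0)).comp ι = 0 := by
          ext v
          exact hsplit u v
        simp [h5]
    · ext v
      · simp
      · have h5 : (fderiv ℝ (fderiv ℝ f) 0 (0, v)).comp ι = hessSnd f 0 v := rfl
        simp [h5, hJb]
  have hGA : ∀ z, G (A₁.prodMap A₂ z) = A₁.prodMap A₂ (G z) := fun z => by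
    refine Prod.ext rfl ?_
    refine form_inverse_equivariant hbJ hJb hs ?_ fun v => ?_
    · intro u v
      rw [← hessSnd_of_invariant hf hA 0 u v, map_zero]
    · simpa [ι] using fderiv_of_invariant hf hA z (0, v)
  obtain ⟨H, hH0, hHs, hHd, hGH, hHG⟩ :=
    exists_smooth_local_inverse (Eventually.of_forall fun z => hG.contDiffAt) hG0 hGd
  have hHA := local_inverse_comm hH0 hHd.continuousAt hGH hHG _ (Eventually.of_forall hGA)
  have hin : Tendsto (fun x : E₁ => (x, (0 : E₂))) (𝓝 0) (𝓝 0) :=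
    (Continuous.prodMk_left (0 : E₂)).tendsto 0
  have hfst : ∀ᶠ x in 𝓝 (0 : E₁), H (x, 0) = (x, (H (x, 0)).2) := by
    filter_upwards [hin.eventually hGH] with x hx
    have hx1 : (H (x, 0)).1 = x := congrArg Prod.fst hx
    exact Prod.ext hx1 rfl
  refine ⟨fun x => (H (x, 0)).2, congrArg Prod.snd hH0, ?_, ?_, ?_, ?_⟩
  · filter_upwards [hin.eventually hHs] with x hx
    exact contDiffAt_snd.comp x (hx.comp x (contDiffAt_id.prodMk contDiffAt_const))
  · have := hasFDerivAt_snd.comp (0 : E₁) (HasFDerivAt.comp (0 : E₁) hHd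
      (hasFDerivAt_prodMk_left (𝕜 := ℝ) (0 : E₁) (0 : E₂)))
    convert! this using 1
  · filter_upwards [hfst, hin.eventually hGH] with x hx hx' v
    rw [← hx]
    have h5 : J ((fderiv ℝ f (H (x, 0))).comp ι) = 0 := congrArg Prod.snd hx'
    have h6 : (fderiv ℝ f (H (x, 0))).comp ι = 0 := by
      rw [← hbJ (ContinuousLinearMap.comp _ _), h5, map_zero]
    exact DFunLike.congr_fun h6 v
  · filter_upwards [hin.eventually hHA] with x hx
    simpa using congrArg Prod.snd hx

/-- Equivariant square root: smoothly in a small symmetric form `M`, the form `b / 2 + M` is the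
pullback of `b / 2` by a linear map close to the identity. -/
theorem exists_form_sqrt [FiniteDimensional ℝ E₂] {b : E₂ →L[ℝ] E₂ →L[ℝ] ℝ}
    (hbs : ∀ u v, b u v = b v u)
    {J : (E₂ →L[ℝ] ℝ) →L[ℝ] E₂} (hbJ : ∀ l, b (J l) = l) (hJb : ∀ v, J (b v) = v)
    (hs : Function.Surjective A₂) (hb : ∀ u v, b (A₂ u) (A₂ v) = b u v) :
    ∃ H : (E₂ →L[ℝ] E₂ →L[ℝ] ℝ) → (E₂ →L[ℝ] E₂ →L[ℝ] ℝ), H 0 = 0 ∧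
      (∀ᶠ M in 𝓝 0, ContDiffAt ℝ ∞ H M) ∧
      (∀ᶠ M in 𝓝 0, (∀ u v, M u v = M v u) → ∀ y,
        1 / 2 * b (y + J (H M y)) (y + J (H M y)) = 1 / 2 * b y y + M y y) ∧
      (∀ᶠ M in 𝓝 0, H (M.bilinearComp A₂ A₂) = (H M).bilinearComp A₂ A₂) := by
  let G : (E₂ →L[ℝ] E₂ →L[ℝ] ℝ) → (E₂ →L[ℝ] E₂ →L[ℝ] ℝ) :=
    fun S => S + (1 / 2 : ℝ) • S.comp (J.comp S)
  have hGa : ∀ S u v, G S u v = S u v + 1 / 2 * S (J (S u)) v := fun S u v => rfl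
  have hG : ContDiff ℝ ∞ G :=
    contDiff_id.add
      ((contDiff_id.clm_comp (contDiff_const.clm_comp contDiff_id)).const_smul (1 / 2 : ℝ))
  have hG0 : G 0 = 0 := by simp [G]
  have hGd : HasFDerivAt G (ContinuousLinearMap.id ℝ _) 0 := by
    have h1 := (hasFDerivAt_id (𝕜 := ℝ) (0 : E₂ →L[ℝ] E₂ →L[ℝ] ℝ)).add
      (((hasFDerivAt_id (𝕜 := ℝ) (0 : E₂ →L[ℝ] E₂ →L[ℝ] ℝ)).clm_comp
        ((hasFDerivAt_const J 0).clm_comp (hasFDerivAt_id 0))).const_smul (1 / 2 : ℝ))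
    convert! h1 using 1
    ext S u v
    simp
  have hJs : ∀ l m : E₂ →L[ℝ] ℝ, l (J m) = m (J l) := fun l m => by
    conv_lhs => rw [← hbJ l]
    conv_rhs => rw [← hbJ m]
    exact hbs _ _
  obtain ⟨H, hH0, hHs, hHd, hGH, hHG⟩ :=
    exists_smooth_local_inverse (Eventually.of_forall fun z => hG.contDiffAt) hG0 hGd
  let flipL : (E₂ →L[ℝ] E₂ →L[ℝ] ℝ) →L[ℝ] (E₂ →L[ℝ] E₂ →L[ℝ] ℝ) :=
    (ContinuousLinearMap.flipₗᵢ ℝ E₂ E₂ ℝ).toLinearIsometry.toContinuousLinearMap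
  have hflip : ∀ S u v, flipL S u v = S v u := fun S u v => rfl
  let pull : (E₂ →L[ℝ] E₂ →L[ℝ] ℝ) →L[ℝ] (E₂ →L[ℝ] E₂ →L[ℝ] ℝ) :=
    LinearMap.toContinuousLinearMap
      { toFun := fun M : E₂ →L[ℝ] E₂ →L[ℝ] ℝ => M.bilinearComp A₂ A₂
        map_add' := fun _ _ => rfl
        map_smul' := fun _ _ => rfl }
  have hpull : ∀ S, pull S = S.bilinearComp A₂ A₂ := fun S => rfl
  have hHf := local_inverse_comm hH0 hHd.continuousAt hGH hHG flipL
    (Eventually.of_forall fun S => by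
      ext u v
      simp only [hGa, hflip]
      rw [hJs]
      rfl)
  have hHp := local_inverse_comm hH0 hHd.continuousAt hGH hHG pull
    (Eventually.of_forall fun S => by
      ext u v
      simp only [hGa, hpull, ContinuousLinearMap.bilinearComp_apply]
      rw [form_inverse_equivariant hbJ hJb hs hb (l := S.bilinearComp A₂ A₂ u) (m := S (A₂ u))
        fun v => rfl])
  refine ⟨H, hH0, hHs, ?_, hHp⟩
  filter_upwards [hHf, hGH] with M h1 h2 hM y
  have h3 : flipL M = M := by
    ext u v
    exact hM v u
  rw [h3] at h1
  have h4 : ∀ u v, H M u v = H M v u := fun u v => by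
    conv_lhs => rw [h1]
    rfl
  have h5 : M y y = H M y y + 1 / 2 * H M (J (H M y)) y := by rw [← hGa, h2]
  simp only [map_add, add_apply, hbJ]
  rw [hbs y (J _), hbJ, h5, h4 (J _) y]
  ring

/-- The equivariant splitting lemma for germs: near the origin, `f` becomes the sum of a function
of the first variable and half its Hessian in the second variable. -/
theorem exists_splitting_germ [FiniteDimensional ℝ E₁] [FiniteDimensional ℝ E₂]
    (hf : ContDiff ℝ ∞ f) (h0 : fderiv ℝ f 0 = 0)
    (hsplit : ∀ u v, fderiv ℝ (fderiv ℝ f) 0 (u, 0) (0, v) = 0)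
    {J : (E₂ →L[ℝ] ℝ) →L[ℝ] E₂} (hbJ : ∀ l, hessSnd f 0 (J l) = l)
    (hJb : ∀ v, J (hessSnd f 0 v) = v) (hs : Function.Surjective A₂)
    (hA : ∀ z, f (A₁.prodMap A₂ z) = f z) :
    ∃ (Ψ : E₁ × E₂ → E₁ × E₂) (g : E₁ → ℝ), Ψ 0 = 0 ∧ (∀ᶠ z in 𝓝 0, ContDiffAt ℝ ∞ Ψ z) ∧
      HasFDerivAt Ψ (ContinuousLinearMap.id ℝ _) 0 ∧
      (∀ᶠ z in 𝓝 0, Ψ (A₁.prodMap A₂ z) = A₁.prodMap A₂ (Ψ z)) ∧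
      (∃ V ∈ 𝓝 0, InjOn Ψ V) ∧ ContDiff ℝ ∞ g ∧
      (∀ᶠ p in 𝓝 0, f (Ψ p) = g p.1 + 1 / 2 * hessSnd f 0 p.2 p.2) := by
  have : CompleteSpace E₁ := FiniteDimensional.complete ℝ E₁
  have : CompleteSpace E₂ := FiniteDimensional.complete ℝ E₂
  have hb : ∀ u v, hessSnd f 0 (A₂ u) (A₂ v) = hessSnd f 0 u v := fun u v => by
    rw [← hessSnd_of_invariant hf hA 0 u v, map_zero]
  obtain ⟨φ, hφ0, hφs, hφd, hφc, hφA⟩ := exists_critical_graph hf h0 hsplit hbJ hJb hs hA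
  obtain ⟨R, hR0, hRs, hRsq, hRA⟩ := exists_form_sqrt (hessSnd_symm hf 0) hbJ hJb hs hb
  have hfst : Tendsto (Prod.fst : E₁ × E₂ → E₁) (𝓝 0) (𝓝 0) := continuous_fst.tendsto 0
  have hT := contDiff_taylorSnd hf
  let M : E₁ × E₂ → (E₂ →L[ℝ] E₂ →L[ℝ] ℝ) := fun z =>
    taylorSnd f ((z.1, φ z.1), z.2) - taylorSnd f (0, 0)
  have hM0 : M 0 = 0 := by
    simp only [M, Prod.fst_zero, Prod.snd_zero, hφ0, Prod.mk_zero_zero, sub_self]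
  have hMs : ∀ᶠ z in 𝓝 0, ContDiffAt ℝ ∞ M z := by
    filter_upwards [hfst.eventually hφs] with z hz
    exact (hT.contDiffAt.comp z ((contDiffAt_fst.prodMk (hz.comp z contDiffAt_fst)).prodMk
      contDiffAt_snd)).sub contDiffAt_const
  have hMt : Tendsto M (𝓝 0) (𝓝 0) := by
    have := hMs.self_of_nhds.continuousAt.tendsto
    rwa [hM0] at this
  have hMsymm : ∀ z u v, M z u v = M z v u := fun z u v => by
    simp only [M, sub_apply, taylorSnd_symm hf _ _ u v]
  have hMA : ∀ᶠ z in 𝓝 0, (M (A₁.prodMap A₂ z)).bilinearComp A₂ A₂ = M z := by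
    filter_upwards [hfst.eventually hφA] with z hz
    ext u v
    have h1 := taylorSnd_of_invariant hf hA (z.1, φ z.1) z.2 u v
    have h2 := taylorSnd_of_invariant hf hA 0 0 u v
    rw [map_zero, map_zero] at h2
    simp only [M, ContinuousLinearMap.bilinearComp_apply, sub_apply, h2, ← h1]
    simp [hz]
  let S : E₁ × E₂ → (E₂ →L[ℝ] E₂ →L[ℝ] ℝ) := fun z => R (M z)
  have hS0 : S 0 = 0 := by simp [S, hM0, hR0]
  have hSs : ∀ᶠ z in 𝓝 0, ContDiffAt ℝ ∞ S z := by
    filter_upwards [hMs, hMt.eventually hRs] with z h1 h2 using h2.comp z h1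
  have hAt : Tendsto (A₁.prodMap A₂) (𝓝 0) (𝓝 0) := by
    have := (A₁.prodMap A₂).continuous.tendsto 0
    rwa [map_zero] at this
  have hSA : ∀ᶠ z in 𝓝 0, (S (A₁.prodMap A₂ z)).bilinearComp A₂ A₂ = S z := by
    filter_upwards [hMA, (hMt.comp hAt).eventually hRA] with z h1 h2
    simp only [Function.comp_apply] at h2
    rw [← h2, h1]
  let Θ : E₁ × E₂ → E₁ × E₂ := fun z => (z.1, z.2 + J (S z z.2))
  have hΘ0 : Θ 0 = 0 := by simp [Θ]
  have hΘs : ∀ᶠ z in 𝓝 0, ContDiffAt ℝ ∞ Θ z := by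
    filter_upwards [hSs] with z hz
    exact contDiffAt_fst.prodMk (contDiffAt_snd.add
      (J.contDiff.contDiffAt.comp z (hz.clm_apply contDiffAt_snd)))
  have hΘd : HasFDerivAt Θ (ContinuousLinearMap.id ℝ _) 0 := by
    have h3 := (hSs.self_of_nhds.differentiableAt (by simp)).hasFDerivAt.clm_apply
      (hasFDerivAt_snd (𝕜 := ℝ) (p := (0 : E₁ × E₂)))
    have h4 := (hasFDerivAt_fst (𝕜 := ℝ) (p := (0 : E₁ × E₂))).prodMk
      ((hasFDerivAt_snd (𝕜 := ℝ) (p := (0 : E₁ × E₂))).add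
        (J.hasFDerivAt.comp (0 : E₁ × E₂) h3))
    convert! h4 using 1
    simp only [hS0]
    ext u <;> simp
  have hΘA : ∀ᶠ z in 𝓝 0, Θ (A₁.prodMap A₂ z) = A₁.prodMap A₂ (Θ z) := by
    filter_upwards [hSA] with z hz
    refine Prod.ext rfl ?_
    change A₂ z.2 + J (S (A₁.prodMap A₂ z) (A₂ z.2)) = A₂ (z.2 + J (S z z.2))
    rw [map_add, form_inverse_equivariant hbJ hJb hs hb (l := S z z.2)]
    intro v
    rw [← hz]
    rfl
  obtain ⟨H, hH0, hHs, hHd, hΘH, hHΘ⟩ := exists_smooth_local_inverse hΘs hΘ0 hΘd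
  have hHA := local_inverse_comm hH0 hHd.continuousAt hΘH hHΘ _ hΘA
  have hHt : Tendsto H (𝓝 0) (𝓝 0) := by
    have := hHd.continuousAt.tendsto
    rwa [hH0] at this
  have hgs : ∀ᶠ x in 𝓝 (0 : E₁), ContDiffAt ℝ ∞ (fun x => f (x, φ x)) x := by
    filter_upwards [hφs] with x hx
    exact hf.contDiffAt.comp x (contDiffAt_id.prodMk hx)
  obtain ⟨g, hg, hgf⟩ := exists_contDiff_eventuallyEq_s7 hgs
  refine ⟨fun z => (z.1, φ z.1 + (H z).2), g, ?_, ?_, ?_, ?_, ?_, hg, ?_⟩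
  · simp [hφ0, hH0]
  · filter_upwards [hfst.eventually hφs, hHs] with z h1 h2
    exact contDiffAt_fst.prodMk ((h1.comp z contDiffAt_fst).add (contDiffAt_snd.comp z h2))
  · have h4 := (hasFDerivAt_fst (𝕜 := ℝ) (p := (0 : E₁ × E₂))).prodMk
      ((HasFDerivAt.comp (0 : E₁ × E₂) hφd hasFDerivAt_fst).add
        (hasFDerivAt_snd.comp (0 : E₁ × E₂) hHd))
    convert! h4 using 1
    ext u <;> simp
  · filter_upwards [hfst.eventually hφA, hHA] with z h1 h2
    refine Prod.ext rfl ?_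
    change φ (A₁ z.1) + (H (A₁.prodMap A₂ z)).2 = A₂ (φ z.1 + (H z).2)
    rw [h1, h2, map_add]
    rfl
  · refine ⟨_, hΘH, fun p hp q hq hpq => ?_⟩
    have h1 : p.1 = q.1 := (Prod.ext_iff.1 hpq).1
    have h2 : φ p.1 + (H p).2 = φ q.1 + (H q).2 := (Prod.ext_iff.1 hpq).2
    have hp1 : (H p).1 = p.1 := (Prod.ext_iff.1 hp).1
    have hq1 : (H q).1 = q.1 := (Prod.ext_iff.1 hq).1
    rw [h1] at h2
    have h3 : H p = H q := Prod.ext (by rw [hp1, hq1, h1]) (add_left_cancel h2)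
    rw [← show Θ (H p) = p from hp, h3]
    exact hq
  · filter_upwards [hΘH, hfst.eventually hgf, hfst.eventually hφc,
      (hMt.comp hHt).eventually hRsq] with z h1 h2 h3 h4
    have hz1 : (H z).1 = z.1 := (Prod.ext_iff.1 h1).1
    have hz2 : (H z).2 + J (R (M (H z)) (H z).2) = z.2 := (Prod.ext_iff.1 h1).2
    have h5 := h4 (hMsymm _) (H z).2
    simp only [Function.comp_apply] at h5
    rw [hz2] at h5
    have h6 := taylor_snd hf (z.1, φ z.1) (H z).2
    have h7 : ((z.1, φ z.1) : E₁ × E₂) + (0, (H z).2) = (z.1, φ z.1 + (H z).2) := by simp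
    have h8 : M (H z) (H z).2 (H z).2 = taylorSnd f ((z.1, φ z.1), (H z).2) (H z).2 (H z).2
        - 1 / 2 * hessSnd f 0 (H z).2 (H z).2 := by
      rw [← taylorSnd_zero hf]
      simp only [M, sub_apply, hz1]
    rw [h7, h3] at h6
    rw [h6, h2, h5, h8]
    ring

end Invariant

/-- A nondegenerate bilinear form on a finite-dimensional space is inverted by a continuous
linear map. -/
theorem exists_form_inverse [FiniteDimensional ℝ E₂] (b : E₂ →L[ℝ] E₂ →L[ℝ] ℝ)
    (hb : ∀ v, b v = 0 → v = 0) :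
    ∃ J : (E₂ →L[ℝ] ℝ) →L[ℝ] E₂, (∀ l, b (J l) = l) ∧ ∀ v, J (b v) = v := by
  have hinj : Function.Injective (b : E₂ →ₗ[ℝ] E₂ →L[ℝ] ℝ) :=
    (injective_iff_map_eq_zero _).2 hb
  have hrank : Module.finrank ℝ E₂ = Module.finrank ℝ (E₂ →L[ℝ] ℝ) := by
    rw [← (LinearMap.toContinuousLinearMap (𝕜 := ℝ) (E := E₂) (F' := ℝ)).finrank_eq]
    exact Subspace.dual_finrank_eq.symm
  let e := LinearEquiv.ofInjectiveOfFinrankEq _ hinj hrank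
  refine ⟨LinearMap.toContinuousLinearMap e.symm.toLinearMap, fun l => ?_, fun v => ?_⟩
  · exact e.apply_symm_apply l
  · exact e.symm_apply_apply v

theorem fderiv_half_form {b : E →L[ℝ] E →L[ℝ] ℝ} (hb : ∀ u v, b u v = b v u) :
    fderiv ℝ (fun v => 1 / 2 * b v v) = b := by
  ext v w
  have h := ((b.hasFDerivAt (x := v)).clm_apply (hasFDerivAt_id v)).const_mul (1 / 2 : ℝ)
  simp only [id] at h
  rw [HasFDerivAt.fderiv h]
  simp only [smul_apply, add_apply, ContinuousLinearMap.comp_apply,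
    ContinuousLinearMap.flip_apply, ContinuousLinearMap.id_apply, smul_eq_mul]
  rw [hb w v]
  ring

end Prelim

/-- Invariant Gromoll–Meyer Splitting Lemma.  Under the hypotheses of the splitting
lemma, if moreover `A (z₁, z₂) = (A₁ z₁, A₂ z₂)` with `A₁, A₂` linear isometries and
`f` is `A`-invariant, then the neighborhood `U` can be taken `A`-invariant and the
splitting embedding `Ψ` can be taken `A`-equivariant. -/
theorem stmt7 {n₁ n₂ : ℕ} (f : Eu n₁ × Eu n₂ → ℝ) (hf : ContDiff ℝ (⊤ : ℕ∞) f)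
    (hcrit : fderiv ℝ f (0, 0) = 0)
    (hiso : ∃ V ∈ nhds ((0, 0) : Eu n₁ × Eu n₂),
      ∀ p ∈ V, fderiv ℝ f p = 0 → p = (0, 0))
    (B : (Eu n₁ × Eu n₂) →L[ℝ] (Eu n₁ × Eu n₂) →L[ℝ] ℝ)
    (hB : B = fderiv ℝ (fderiv ℝ f) (0, 0))
    (hsplit : ∀ (u : Eu n₁) (v : Eu n₂), B (u, 0) (0, v) = 0)
    (hker : ∀ w : Eu n₁ × Eu n₂, (∀ w', B w w' = 0) → w.2 = 0)
    (A₁ : Eu n₁ →ₗᵢ[ℝ] Eu n₁) (A₂ : Eu n₂ →ₗᵢ[ℝ] Eu n₂)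
    (hinv : ∀ z : Eu n₁ × Eu n₂, f (A₁ z.1, A₂ z.2) = f z) :
    ∃ (U : Set (Eu n₁ × Eu n₂)) (Ψ : Eu n₁ × Eu n₂ → Eu n₁ × Eu n₂)
      (g : Eu n₁ → ℝ) (h : Eu n₂ → ℝ),
      IsOpen U ∧ ((0, 0) : Eu n₁ × Eu n₂) ∈ U ∧
      (fun z : Eu n₁ × Eu n₂ => ((A₁ z.1, A₂ z.2) : Eu n₁ × Eu n₂)) '' U = U ∧
      ContDiffOn ℝ (⊤ : ℕ∞) Ψ U ∧ Set.InjOn Ψ U ∧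
      Ψ (0, 0) = (0, 0) ∧
      fderiv ℝ Ψ (0, 0) = ContinuousLinearMap.id ℝ (Eu n₁ × Eu n₂) ∧
      (∀ z ∈ U, Ψ (A₁ z.1, A₂ z.2) = (A₁ (Ψ z).1, A₂ (Ψ z).2)) ∧
      ContDiff ℝ (⊤ : ℕ∞) g ∧ ContDiff ℝ (⊤ : ℕ∞) h ∧
      (∀ p ∈ U, f (Ψ p) = g p.1 + h p.2) ∧
      fderiv ℝ h 0 = 0 ∧
      (∀ v : Eu n₂, (∀ v', fderiv ℝ (fderiv ℝ h) 0 v v' = 0) → v = 0) := by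
  let a₁ : Eu n₁ →L[ℝ] Eu n₁ := A₁.toContinuousLinearMap
  let a₂ : Eu n₂ →L[ℝ] Eu n₂ := A₂.toContinuousLinearMap
  have hs₁ : Function.Surjective A₁ :=
    LinearMap.injective_iff_surjective (f := A₁.toLinearMap).1 A₁.injective
  have hs₂ : Function.Surjective A₂ :=
    LinearMap.injective_iff_surjective (f := A₂.toLinearMap).1 A₂.injective
  have hb : ∀ v, hessSnd f 0 v = 0 → v = 0 := fun v hv => by
    refine hker (0, v) fun w => ?_
    have hsymm : B (0, v) (w.1, 0) = B (w.1, 0) (0, v) := by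
      rw [hB]
      exact (hf.contDiffAt.isSymmSndFDerivAt (by
        rw [minSmoothness_of_isRCLikeNormedField]
        exact ENat.LEInfty.out)).eq _ _
    have hv' : B (0, v) (0, w.2) = 0 := by
      rw [hB]
      exact DFunLike.congr_fun hv w.2
    rw [show w = (w.1, 0) + (0, w.2) by simp, map_add, hsymm, hsplit, hv', add_zero]
  obtain ⟨J, hbJ, hJb⟩ := exists_form_inverse (hessSnd f 0) hb
  obtain ⟨Ψ, g, hΨ0, hΨs, hΨd, hΨA, ⟨V, hV, hinj⟩, hg, hfΨ⟩ :=
    exists_splitting_germ (A₁ := a₁) (A₂ := a₂) hf hcrit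
      (fun u v => by subst hB; exact hsplit u v) hbJ hJb hs₂ hinv
  obtain ⟨r, hr, hball⟩ := Metric.eventually_nhds_iff_ball.1
    (hΨs.and (hΨA.and (hfΨ.and (eventually_mem_set.2 hV))))
  have hnorm : ∀ z : Eu n₁ × Eu n₂, ‖((A₁ z.1, A₂ z.2) : Eu n₁ × Eu n₂)‖ = ‖z‖ := fun z => by
    simp [Prod.norm_def]
  have hfd := fderiv_half_form (hessSnd_symm hf 0)
  refine ⟨Metric.ball 0 r, Ψ, g, fun v => 1 / 2 * hessSnd f 0 v v, Metric.isOpen_ball,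
    Metric.mem_ball_self hr, ?_, fun z hz => (hball z hz).1.contDiffWithinAt,
    hinj.mono fun z hz => (hball z hz).2.2.2, hΨ0, hΨd.fderiv, fun z hz => (hball z hz).2.1,
    hg, ?_, fun z hz => (hball z hz).2.2.1, ?_, fun v hv => ?_⟩
  · ext w
    simp only [mem_image, mem_ball_zero_iff]
    constructor
    · rintro ⟨z, hz, rfl⟩
      rwa [hnorm]
    · intro hw
      obtain ⟨x, hx⟩ := hs₁ w.1
      obtain ⟨y, hy⟩ := hs₂ w.2
      have hxy : ((A₁ x, A₂ y) : Eu n₁ × Eu n₂) = w := Prod.ext hx hy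
      exact ⟨(x, y), by rwa [← hnorm, hxy], hxy⟩
  · exact contDiff_const.mul
      (((hessSnd f 0).contDiff.clm_apply contDiff_id))
  · rw [hfd, map_zero]
  · refine hb v (ContinuousLinearMap.ext fun w => ?_)
    rw [hfd] at hv
    simpa using hv w
end

section
/- Let f : ℝ^{n₁} × ℝ^{n₂} → ℝ be a smooth function such that (0,0) is an isolated critical point. Suppose that ∂₂f(z₁, 0) = 0 for all z₁ in a neighborhood of 0 in ℝ^{n₁} (i.e. the partial derivative of f in the second factor vanishes along ℝ^{n₁} × {0}, so the Euclidean gradient of f is tangent to ℝ^{n₁} × {0} there), and that the restriction of the bilinear form D²f(0,0) to {0} × ℝ^{n₂} is nondegenerate. Then there exist an open neighborhood U of (0,0) and a smooth injective map Φ : U → ℝ^{n₁} × ℝ^{n₂} with DΦ(0,0) = id which fixes points of ℝ^{n₁} × {0}, i.e. Φ(z₁,0) = (z₁,0) for (z₁,0) ∈ U, such that f(Φ(z₁,z₂)) = f(z₁,0) + (1/2)·D²f(0,0)((0,z₂),(0,z₂)) for all (z₁,z₂) ∈ U. -/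
open Filter Topology Set
open scoped ContDiff

section ParametricIntegral

universe u

variable {E : Type u} [NormedAddCommGroup E] [NormedSpace ℝ E] [ProperSpace E]

theorem hasFDerivAt_intervalIntegral_of_contDiff {G : Type*} [NormedAddCommGroup G]
    [NormedSpace ℝ G] {F : E × ℝ → G} (hF : ContDiff ℝ 1 F) (a b : ℝ) (x₀ : E) :
    HasFDerivAt (fun x => ∫ t in a..b, F (x, t))
      (∫ t in a..b, (fderiv ℝ F (x₀, t)).comp (ContinuousLinearMap.inl ℝ E ℝ)) x₀ := by
  have hc : Continuous fun p : E × ℝ =>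
      (fderiv ℝ F p).comp (ContinuousLinearMap.inl ℝ E ℝ) :=
    (hF.continuous_fderiv one_ne_zero).clm_comp continuous_const
  obtain ⟨C, hC⟩ := ((isCompact_closedBall x₀ 1).prod (isCompact_uIcc (a := a) (b := b)))
    |>.exists_bound_of_continuousOn hc.continuousOn
  refine intervalIntegral.hasFDerivAt_integral_of_dominated_of_fderiv_le
    (F := fun x t => F (x, t))
    (F' := fun x t => (fderiv ℝ F (x, t)).comp (ContinuousLinearMap.inl ℝ E ℝ))
    (bound := fun _ => C) (Metric.closedBall_mem_nhds x₀ one_pos) ?_ ?_ ?_ ?_ ?_ ?_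
  · exact .of_forall fun x =>
      (hF.continuous.comp (Continuous.prodMk_right x)).aestronglyMeasurable
  · exact (hF.continuous.comp (Continuous.prodMk_right x₀)).intervalIntegrable _ _
  · exact (hc.comp (Continuous.prodMk_right x₀)).aestronglyMeasurable
  · exact .of_forall fun t ht x hx => hC (x, t) ⟨hx, uIoc_subset_uIcc ht⟩
  · exact intervalIntegrable_const
  · refine .of_forall fun t _ x _ => ?_
    exact ((hF.differentiable one_ne_zero (x, t)).hasFDerivAt).comp x
      (hasFDerivAt_prodMk_left x t)

theorem ContDiff.intervalIntegral_param_nat {G : Type u} [NormedAddCommGroup G]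
    [NormedSpace ℝ G] {F : E × ℝ → G} (a b : ℝ) (n : ℕ) (hF : ContDiff ℝ n F) :
    ContDiff ℝ n fun x => ∫ t in a..b, F (x, t) := by
  induction n generalizing G with
  | zero =>
    refine contDiff_zero.2 ?_
    exact intervalIntegral.continuous_parametric_intervalIntegral_of_continuous'
      (f := fun x t => F (x, t)) hF.continuous a b
  | succ n ih =>
    push_cast at hF ⊢
    refine contDiff_succ_iff_hasFDerivAt.2 ⟨_, ?_, fun x =>
      hasFDerivAt_intervalIntegral_of_contDiff (hF.of_le (by simp)) a b x⟩
    exact ih ((hF.fderiv_right le_rfl).clm_comp contDiff_const)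

theorem ContDiff.intervalIntegral_param {G : Type u} [NormedAddCommGroup G]
    [NormedSpace ℝ G] {F : E × ℝ → G} (hF : ContDiff ℝ ∞ F) (a b : ℝ) :
    ContDiff ℝ ∞ fun x => ∫ t in a..b, F (x, t) :=
  contDiff_infty.2 fun n => .intervalIntegral_param_nat a b n (contDiff_infty.1 hF n)

end ParametricIntegral

/-- Inverse function theorem giving smoothness of the inverse on its whole domain. -/
theorem exists_openPartialHomeomorph_contDiffOn_symm {E F : Type*} [NormedAddCommGroup E]
    [NormedSpace ℝ E] [CompleteSpace E] [NormedAddCommGroup F] [NormedSpace ℝ F]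
    {f : E → F} {a : E} {f' : E ≃L[ℝ] F} (hf : ∀ᶠ x in 𝓝 a, ContDiffAt ℝ ∞ f x)
    (hf' : HasFDerivAt f (f' : E →L[ℝ] F) a) :
    ∃ φ : OpenPartialHomeomorph E F, a ∈ φ.source ∧ ⇑φ = f ∧
      ∀ y ∈ φ.target, ContDiffAt ℝ ∞ φ.symm y := by
  have ha := hf.self_of_nhds
  have hcont : ContinuousAt (fderiv ℝ f) a := (ha.fderiv_right (m := 0) (by simp)).continuousAt
  have hinv : ∀ᶠ x in 𝓝 a, fderiv ℝ f x ∈ range ((↑) : (E ≃L[ℝ] F) → E →L[ℝ] F) :=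
    hcont.eventually (by rw [hf'.fderiv]; exact f'.nhds)
  obtain ⟨O, hO, hOo, haO⟩ := eventually_nhds_iff.1 (hf.and hinv)
  refine ⟨(ha.toOpenPartialHomeomorph f hf' (by simp)).restrOpen O hOo,
    ⟨ha.mem_toOpenPartialHomeomorph_source hf' (by simp), haO⟩, rfl, fun y hy => ?_⟩
  obtain ⟨hs, e, he⟩ := hO _ (((ha.toOpenPartialHomeomorph f hf' (by simp)).restrOpen O
    hOo).map_target hy).2
  refine OpenPartialHomeomorph.contDiffAt_symm _ hy (f₀' := e) ?_ hs
  rw [he]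
  exact (hs.differentiableAt (by simp)).hasFDerivAt

theorem exists_openPartialHomeomorph_mul_self {A : Type*} [NormedRing A] [NormedAlgebra ℝ A]
    [CompleteSpace A] :
    ∃ φ : OpenPartialHomeomorph A A, 1 ∈ φ.source ∧ (⇑φ = fun R => R * R) ∧
      ∀ y ∈ φ.target, ContDiffAt ℝ ∞ φ.symm y := by
  refine exists_openPartialHomeomorph_contDiffOn_symm
    (f' := ContinuousLinearEquiv.smulLeft (Units.mk0 (2 : ℝ) two_ne_zero))
    (.of_forall fun R => (contDiff_id.mul contDiff_id).contDiffAt) ?_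
  refine ((hasFDerivAt_id (𝕜 := ℝ) (1 : A)).mul' (hasFDerivAt_id (1 : A))).congr_fderiv ?_
  ext R
  simp [two_smul, Units.smul_def]

/-- Symmetric bilinear forms near a nondegenerate symmetric form `b` are pullbacks of `b` by
linear maps depending smoothly on the form. -/
theorem exists_contDiffAt_bilinear_congruence {E : Type*} [NormedAddCommGroup E]
    [NormedSpace ℝ E] [FiniteDimensional ℝ E] (b : E →L[ℝ] E →L[ℝ] ℝ)
    (hsymm : ∀ x y, b x y = b y x) (hnd : ∀ x, (∀ y, b x y = 0) → x = 0) :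
    ∃ s : (E →L[ℝ] E →L[ℝ] ℝ) → (E →L[ℝ] E), s b = ContinuousLinearMap.id ℝ E ∧
      (∀ᶠ a in 𝓝 b, ContDiffAt ℝ ∞ s a) ∧
      ∀ᶠ a in 𝓝 b, (∀ x y, a x y = a y x) → ∀ x y, b (s a x) (s a y) = a x y := by
  have : CompleteSpace E := FiniteDimensional.complete ℝ E
  have hinj : Function.Injective b := by
    refine (injective_iff_map_eq_zero b).2 fun x hx => hnd x fun y => ?_
    rw [hx]; rfl
  have hdim : Module.finrank ℝ E = Module.finrank ℝ (E →L[ℝ] ℝ) := by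
    rw [← LinearMap.toContinuousLinearMap (𝕜 := ℝ) (E := E) (F' := ℝ) |>.finrank_eq]
    exact (Subspace.dual_finrank_eq (K := ℝ) (V := E)).symm
  let e : E ≃L[ℝ] (E →L[ℝ] ℝ) :=
    (LinearEquiv.ofInjectiveOfFinrankEq (b : E →ₗ[ℝ] E →L[ℝ] ℝ) hinj hdim).toContinuousLinearEquiv
  have hbe : ∀ l y, b (e.symm l) y = l y := fun l y =>
    DFunLike.congr_fun (e.apply_symm_apply l) y
  have hext : ∀ {P Q : E →L[ℝ] E}, (∀ x y, b (P x) y = b (Q x) y) → P = Q := fun h =>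
    ContinuousLinearMap.ext fun x => hinj (ContinuousLinearMap.ext (h x))
  -- `σ` is the adjoint with respect to `b`
  let σ : (E →L[ℝ] E) → (E →L[ℝ] E) := fun R =>
    (e.symm : (E →L[ℝ] ℝ) →L[ℝ] E).comp
      (((ContinuousLinearMap.compL ℝ E E ℝ).flip R).comp b)
  have hσ : ∀ R x y, b (σ R x) y = b x (R y) := fun R x y => hbe _ _
  have hσc : Continuous σ := by fun_prop
  have hσ1 : σ 1 = 1 := hext fun x y => hσ 1 x y
  let c : (E →L[ℝ] E →L[ℝ] ℝ) → (E →L[ℝ] E) := fun a =>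
    (e.symm : (E →L[ℝ] ℝ) →L[ℝ] E).comp a
  have hc : ∀ a x y, b (c a x) y = a x y := fun a x y => hbe _ _
  have hcs : ContDiff ℝ ∞ c := contDiff_const.clm_comp contDiff_id
  have hcb : c b = 1 := hext fun x y => hc b x y
  obtain ⟨φ, h1, hφ, hφs⟩ := exists_openPartialHomeomorph_mul_self (A := E →L[ℝ] E)
  have hφ1 : φ 1 = 1 := by simp [hφ]
  have h1t : (1 : E →L[ℝ] E) ∈ φ.target := by simpa [hφ1] using φ.map_source h1
  have hs1 : φ.symm 1 = 1 := by simpa [hφ1] using φ.left_inv h1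
  have hsc : ContinuousAt (fun a => φ.symm (c a)) b := by
    have h := (φ.continuousAt_symm h1t)
    rw [← hcb] at h
    exact ContinuousAt.comp (f := c) h hcs.continuous.continuousAt
  have ht : ∀ᶠ a in 𝓝 b, c a ∈ φ.target :=
    hcs.continuous.continuousAt.eventually (by rw [hcb]; exact φ.open_target.mem_nhds h1t)
  have hσs : ∀ᶠ a in 𝓝 b, σ (φ.symm (c a)) ∈ φ.source := by
    refine (hσc.continuousAt.comp hsc).eventually ?_
    simp only [Function.comp, hcb, hs1, hσ1]
    exact φ.open_source.mem_nhds h1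
  refine ⟨fun a => φ.symm (c a), by simp only [hcb, hs1]; rfl, ?_, ?_⟩
  · filter_upwards [ht] with a ha
    exact (hφs _ ha).comp a hcs.contDiffAt
  · filter_upwards [ht, hσs] with a ha hσa hsym x y
    set R := φ.symm (c a) with hR
    have hRR : ∀ x, R (R x) = c a x := fun x => by
      have h : φ R = c a := φ.right_inv ha
      rw [hφ] at h
      exact DFunLike.congr_fun h x
    have hfix : σ R = R := by
      refine φ.injOn hσa (φ.map_target ha) ?_
      simp only [hφ]
      refine hext fun x y => ?_
      simp only [mul_apply_eq_comp, hσ, hRR]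
      rw [hsymm, hc, hc, hsym]
    calc b (R x) (R y) = b (σ R (R x)) y := (hσ _ _ _).symm
      _ = a x y := by rw [hfix, hRR, hc]

/-- Taylor expansion to second order along the second factor, with the remainder as a smooth
family of symmetric bilinear forms. -/
theorem exists_contDiff_bilinear_remainder {E₁ E₂ : Type} [NormedAddCommGroup E₁]
    [NormedSpace ℝ E₁] [FiniteDimensional ℝ E₁] [NormedAddCommGroup E₂] [NormedSpace ℝ E₂]
    [FiniteDimensional ℝ E₂] {f : E₁ × E₂ → ℝ} (hf : ContDiff ℝ ∞ f) :
    ∃ A : E₁ × E₂ → E₂ →L[ℝ] E₂ →L[ℝ] ℝ, ContDiff ℝ ∞ A ∧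
      (∀ x y, A 0 x y = fderiv ℝ (fderiv ℝ f) 0 (0, x) (0, y)) ∧
      (∀ z x y, A z x y = A z y x) ∧
      ∀ z : E₁ × E₂, f z = f (z.1, 0) + fderiv ℝ f (z.1, 0) (0, z.2) +
        (1 / 2) * A z z.2 z.2 := by
  have : ProperSpace (E₁ × E₂) := FiniteDimensional.proper ℝ _
  have hf1 : ContDiff ℝ ∞ (fderiv ℝ f) := hf.fderiv_right (by simp)
  have hf2 : ContDiff ℝ ∞ (fderiv ℝ (fderiv ℝ f)) := hf1.fderiv_right (by simp)
  let ι := ContinuousLinearMap.inr ℝ E₁ E₂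
  let H : E₁ × E₂ → E₂ →L[ℝ] E₂ →L[ℝ] ℝ := fun p =>
    ((ContinuousLinearMap.compL ℝ E₂ (E₁ × E₂) ℝ).flip ι).comp
      ((fderiv ℝ (fderiv ℝ f) p).comp ι)
  have hH : ContDiff ℝ ∞ H := contDiff_const.clm_comp (hf2.clm_comp contDiff_const)
  have hHa : ∀ p x y, H p x y = fderiv ℝ (fderiv ℝ f) p (0, x) (0, y) := fun p x y => rfl
  let F : (E₁ × E₂) × ℝ → E₂ →L[ℝ] E₂ →L[ℝ] ℝ := fun q =>
    (2 * (1 - q.2)) • H (q.1.1, q.2 • q.1.2)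
  have hF : ContDiff ℝ ∞ F := by
    have h : ContDiff ℝ ∞ fun q : (E₁ × E₂) × ℝ => (q.1.1, q.2 • q.1.2) := by fun_prop
    have hsmul : ∀ {G : Type} [NormedAddCommGroup G] [NormedSpace ℝ G]
        {k : (E₁ × E₂) × ℝ → G}, ContDiff ℝ ∞ k →
        ContDiff ℝ ∞ fun q => (2 * (1 - q.2)) • k q := fun hk =>
      (by fun_prop : ContDiff ℝ ∞ fun q : (E₁ × E₂) × ℝ => 2 * (1 - q.2)).smul hk
    exact hsmul (hH.comp h)
  have hA : ∀ z x y, (∫ t in (0 : ℝ)..1, F (z, t)) x y =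
      ∫ t in (0 : ℝ)..1, 2 * (1 - t) * H (z.1, t • z.2) x y := fun z x y => by
    have hFz : Continuous fun t => F (z, t) := hF.continuous.comp (Continuous.prodMk_right z)
    rw [ContinuousLinearMap.intervalIntegral_apply (hFz.intervalIntegrable _ _),
      ContinuousLinearMap.intervalIntegral_apply
        ((hFz.clm_apply continuous_const).intervalIntegrable _ _)]
    rfl
  refine ⟨fun z => ∫ t in (0 : ℝ)..1, F (z, t), hF.intervalIntegral_param 0 1, ?_, ?_, ?_⟩
  · intro x y
    have h2 : ∫ t in (0 : ℝ)..1, 2 * (1 - t) = 1 := by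
      rw [intervalIntegral.integral_const_mul, intervalIntegral.integral_sub (by simp) (by simp)]
      norm_num
    simp only [hA, Prod.fst_zero, Prod.snd_zero, smul_zero,
      intervalIntegral.integral_mul_const, h2, one_mul, hHa]
    rfl
  · intro z x y
    have hs : ∀ p, IsSymmSndFDerivAt ℝ f p := fun p =>
      hf.contDiffAt.isSymmSndFDerivAt (by
      rw [minSmoothness_of_isRCLikeNormedField]
      exact WithTop.coe_le_coe.2 le_top)
    simp only [hA, hHa, (hs _).eq (0, x) (0, y)]
  · intro z
    have hγ : ∀ t : ℝ, HasDerivAt (fun t : ℝ => (z.1, t • z.2)) ((0 : E₁), z.2) t := fun t => by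
      simpa using (hasDerivAt_const t z.1).prodMk ((hasDerivAt_id t).smul_const z.2)
    have hd0 : ∀ t : ℝ, HasDerivAt (fun t : ℝ => f (z.1, t • z.2))
        (fderiv ℝ f (z.1, t • z.2) (0, z.2)) t := fun t =>
      ((hf.differentiable (by simp) _).hasFDerivAt).comp_hasDerivAt t (hγ t)
    have hd1 : ∀ t : ℝ, HasDerivAt (fun t : ℝ => fderiv ℝ f (z.1, t • z.2) (0, z.2))
        (H (z.1, t • z.2) z.2 z.2) t := fun t => by
      have h := ((hf1.differentiable (by simp) (z.1, t • z.2)).hasFDerivAt).comp_hasDerivAt t (hγ t)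
      simpa [hHa] using h.clm_apply (hasDerivAt_const t ((0 : E₁), z.2))
    have hd : ∀ t : ℝ, HasDerivAt
        (fun t : ℝ => 2 * (f (z.1, t • z.2) + (1 - t) * fderiv ℝ f (z.1, t • z.2) (0, z.2)))
        (2 * (1 - t) * H (z.1, t • z.2) z.2 z.2) t := fun t => by
      refine (((hd0 t).add (((hasDerivAt_id t).const_sub 1).mul (hd1 t))).const_mul 2).congr_deriv ?_
      simp only [id]
      ring
    have hcont : Continuous fun t : ℝ => 2 * (1 - t) * H (z.1, t • z.2) z.2 z.2 := by
      have hHc := hH.continuous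
      fun_prop
    have hI := intervalIntegral.integral_eq_sub_of_hasDerivAt (fun t _ => hd t)
      (hcont.intervalIntegrable 0 1)
    simp only [hA, hI]
    simp only [one_smul, zero_smul]
    ring

/-- If `(0,0)` is an isolated critical point of the smooth function `f`, the partial
derivative of `f` in the second factor vanishes along `ℝ^{n₁} × {0}` near the origin,
and the restriction of `B = D²f(0,0)` to `{0} × ℝ^{n₂}` is nondegenerate, then there
is a smooth injective map `Φ` on a neighborhood `U` of the origin with `DΦ(0,0) = id`
fixing `ℝ^{n₁} × {0}`, such that
`f (Φ (z₁,z₂)) = f (z₁,0) + (1/2) B (0,z₂) (0,z₂)` on `U`. -/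
theorem stmt8 {n₁ n₂ : ℕ} (f : Eu n₁ × Eu n₂ → ℝ) (hf : ContDiff ℝ (⊤ : ℕ∞) f)
    (hcrit : fderiv ℝ f (0, 0) = 0)
    (hiso : ∃ V ∈ nhds ((0, 0) : Eu n₁ × Eu n₂),
      ∀ p ∈ V, fderiv ℝ f p = 0 → p = (0, 0))
    (htang : ∃ W ∈ nhds (0 : Eu n₁),
      ∀ z₁ ∈ W, fderiv ℝ (fun w : Eu n₂ => f (z₁, w)) 0 = 0)
    (B : (Eu n₁ × Eu n₂) →L[ℝ] (Eu n₁ × Eu n₂) →L[ℝ] ℝ)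
    (hB : B = fderiv ℝ (fderiv ℝ f) (0, 0))
    (hnd : ∀ v : Eu n₂, (∀ v' : Eu n₂, B (0, v) (0, v') = 0) → v = 0) :
    ∃ (U : Set (Eu n₁ × Eu n₂)) (Φ : Eu n₁ × Eu n₂ → Eu n₁ × Eu n₂),
      IsOpen U ∧ ((0, 0) : Eu n₁ × Eu n₂) ∈ U ∧
      ContDiffOn ℝ (⊤ : ℕ∞) Φ U ∧ Set.InjOn Φ U ∧
      fderiv ℝ Φ (0, 0) = ContinuousLinearMap.id ℝ (Eu n₁ × Eu n₂) ∧
      (∀ z₁ : Eu n₁, ((z₁, (0 : Eu n₂)) ∈ U) → Φ (z₁, 0) = (z₁, 0)) ∧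
      (∀ p ∈ U, f (Φ p) = f (p.1, 0) + (1 / 2) * B (0, p.2) (0, p.2)) := by
  obtain ⟨A, hA, hA0, hAs, hAf⟩ := exists_contDiff_bilinear_remainder hf
  have hBA : ∀ x y, A 0 x y = B (0, x) (0, y) := by rw [hB]; exact hA0
  obtain ⟨s, hs0, hss, hsb⟩ := exists_contDiffAt_bilinear_congruence (A 0) (hAs 0)
    fun x hx => hnd x fun y => by rw [← hBA, hx]
  let R : Eu n₁ × Eu n₂ → Eu n₂ →L[ℝ] Eu n₂ := fun z => s (A z)
  have hR0 : R 0 = ContinuousLinearMap.id ℝ (Eu n₂) := hs0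
  have hRs : ∀ᶠ z in 𝓝 0, ContDiffAt ℝ ∞ R z := by
    filter_upwards [hA.continuous.continuousAt.eventually hss] with z hz
    exact hz.comp z hA.contDiffAt
  have hRb : ∀ᶠ z in 𝓝 0, ∀ x y, A 0 (R z x) (R z y) = A z x y := by
    filter_upwards [hA.continuous.continuousAt.eventually hsb] with z hz
    exact hz (hAs z)
  let Ψ : Eu n₁ × Eu n₂ → Eu n₁ × Eu n₂ := fun z => (z.1, R z z.2)
  have hΨ0 : ∀ z₁, Ψ (z₁, 0) = (z₁, 0) := fun z₁ => by simp [Ψ]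
  have hΨs : ∀ᶠ z in 𝓝 0, ContDiffAt ℝ ∞ Ψ z := by
    filter_upwards [hRs] with z hz
    exact contDiffAt_fst.prodMk (hz.clm_apply contDiffAt_snd)
  have hΨd : HasFDerivAt Ψ (ContinuousLinearEquiv.refl ℝ (Eu n₁ × Eu n₂) :
      (Eu n₁ × Eu n₂) →L[ℝ] (Eu n₁ × Eu n₂)) 0 := by
    have hR := (hRs.self_of_nhds.differentiableAt (by simp)).hasFDerivAt
    refine (hasFDerivAt_fst.prodMk (hR.clm_apply hasFDerivAt_snd)).congr_fderiv ?_
    refine ContinuousLinearMap.ext fun v => ?_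
    simp [hR0]
  obtain ⟨φ, hφ0, hφ, hφs⟩ := exists_openPartialHomeomorph_contDiffOn_symm hΨs hΨd
  have hφ00 : φ 0 = 0 := by rw [hφ]; exact hΨ0 0
  have h0t : (0 : Eu n₁ × Eu n₂) ∈ φ.target := by simpa [hφ00] using φ.map_source hφ0
  have hs00 : φ.symm 0 = 0 := by simpa [hφ00] using φ.left_inv hφ0
  obtain ⟨W, hW, hWf⟩ := htang
  have htan : ∀ᶠ z : Eu n₁ × Eu n₂ in 𝓝 0, fderiv ℝ f (z.1, 0) (0, z.2) = 0 := by
    filter_upwards [continuousAt_fst.eventually hW] with z hz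
    have h : HasFDerivAt (fun w => f (z.1, w)) _ 0 :=
      ((hf.differentiable (by simp) (z.1, 0)).hasFDerivAt).comp (0 : Eu n₂)
        (hasFDerivAt_prodMk_right z.1 0)
    have h' := h.fderiv
    rw [hWf _ hz] at h'
    exact (DFunLike.congr_fun h' z.2).symm
  have hgood := (φ.continuousAt_symm h0t).eventually (by rw [hs00]; exact hRb.and htan)
  have hsrc : ∀ᶠ p : Eu n₁ × Eu n₂ in 𝓝 0, (p.1, (0 : Eu n₂)) ∈ φ.source :=
    (by fun_prop : Continuous fun p : Eu n₁ × Eu n₂ => (p.1, (0 : Eu n₂))).continuousAt.eventually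
      (φ.open_source.mem_nhds hφ0)
  obtain ⟨U, hU, hUo, h0U⟩ := eventually_nhds_iff.1
    ((φ.open_target.eventually_mem h0t).and (hgood.and hsrc))
  refine ⟨U, φ.symm, hUo, h0U, fun p hp => (hφs p (hU p hp).1).contDiffWithinAt,
    φ.symm.injOn.mono fun p hp => (hU p hp).1, ?_, fun z₁ hz => ?_, fun p hp => ?_⟩
  · exact (φ.hasFDerivAt_symm (f' := ContinuousLinearEquiv.refl ℝ _) h0t
      (by rw [hs00, hφ]; exact hΨd)).fderiv
  · have h := φ.left_inv (hU _ hz).2.2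
    rwa [hφ, hΨ0] at h
  · obtain ⟨hpt, ⟨hb, ht⟩, -⟩ := hU p hp
    have h := φ.right_inv hpt
    rw [hφ] at h
    have h₁ : (φ.symm p).1 = p.1 :=
      (rfl : _ = (Ψ (φ.symm p)).1).trans (by rw [h])
    have h₂ : R (φ.symm p) (φ.symm p).2 = p.2 :=
      (rfl : _ = (Ψ (φ.symm p)).2).trans (by rw [h])
    rw [hAf, ht, ← hb, h₂, h₁, hBA, add_zero]
end
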